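/- arXiv:2503.18685 — 2 statements merged into one kernel-verified Lean document; each statement's English description precedes it below -/
import Mathlib

section
/- For even-order OSASMs, the number of A ∈ OSASM(2n) with R(A) = r₀ and T(A) = t₀ equals the number of A ∈ OSASM(2n) with R(A) = r₀ and T(A) = 2n+2−t₀, for any r₀ and t₀. -/
open Finset

/-- An alternating sign matrix: entries in {-1,0,1}, all row/column prefix sums in {0,1}
(equivalent to the nonzero entries alternating in sign starting and ending with 1),
and all row and column sums equal to 1. -/
def IsASM {n : ℕ} (A : Matrix (Fin n) (Fin n) ℤ) : Prop :=
  (∀ i j, A i j = -1 ∨ A i j = 0 ∨ A i j = 1) ∧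
  (∀ i k : Fin n, (∑ j ∈ Finset.univ.filter (fun j => j ≤ k), A i j) = 0 ∨
                  (∑ j ∈ Finset.univ.filter (fun j => j ≤ k), A i j) = 1) ∧
  (∀ j k : Fin n, (∑ i ∈ Finset.univ.filter (fun i => i ≤ k), A i j) = 0 ∨
                  (∑ i ∈ Finset.univ.filter (fun i => i ≤ k), A i j) = 1) ∧
  (∀ i, ∑ j, A i j = 1) ∧
  (∀ j, ∑ i, A i j = 1)

/-- A diagonally symmetric ASM. -/
def IsDSASM {n : ℕ} (A : Matrix (Fin n) (Fin n) ℤ) : Prop :=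
  IsASM A ∧ A.IsSymm

/-- An even-order off-diagonally symmetric ASM: a DSASM with all diagonal entries zero. -/
def IsOSASMeven {n : ℕ} (A : Matrix (Fin n) (Fin n) ℤ) : Prop :=
  IsDSASM A ∧ ∀ i, A i i = 0

/-- An odd-order off-diagonally symmetric ASM: a DSASM with exactly one nonzero diagonal entry. -/
def IsOSASModd {n : ℕ} (A : Matrix (Fin n) (Fin n) ℤ) : Prop :=
  IsDSASM A ∧ (Finset.univ.filter (fun i => A i i ≠ 0)).card = 1

/-- R(A): the number of nonzero entries strictly above the diagonal. -/
def Rstat {n : ℕ} (A : Matrix (Fin n) (Fin n) ℤ) : ℕ :=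
  ∑ p ∈ Finset.univ.filter (fun p : Fin n × Fin n => p.1 < p.2), (A p.1 p.2).natAbs

/-- S(A): the number of nonzero diagonal entries. -/
def Sstat {n : ℕ} (A : Matrix (Fin n) (Fin n) ℤ) : ℕ :=
  ∑ i, (A i i).natAbs

/-- T(A): the (1-based) column index of the unique 1 in the first row
(for an ASM, the first row has a single nonzero entry, which equals 1). -/
def Tstat {n : ℕ} (A : Matrix (Fin n) (Fin n) ℤ) : ℕ :=
  ∑ p ∈ Finset.univ.filter (fun p : Fin n × Fin n => p.1.1 = 0),
    (p.2.1 + 1) * (A p.1 p.2).natAbs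

/-- Weights of the six-vertex model, as functions of the spectral parameter: `a` and `b` for the
zero entries of an alternating sign matrix, `c` for the entries `1` and `d` for the entries `-1`. -/
structure VertexWeights where
  a : ℝ → ℝ
  b : ℝ → ℝ
  c : ℝ → ℝ
  d : ℝ → ℝ

/-- The trigonometric weights, in the gauge where all of them are polynomial. -/
def trigWeights (p q e : ℝ) : VertexWeights where
  a X := e * (p * X - q)
  b X := e * (p - q * X)
  c _ := e * (p ^ 2 - q ^ 2)
  d X := e * (p ^ 2 - q ^ 2) * X

/-- The weighted sum over the outgoing states of a vertex with incoming states `t` and `s`. -/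
def vertex (W : VertexWeights) (X : ℝ) : Bool → Bool → (Bool → Bool → ℝ) → ℝ
  | false, false, k => W.a X * k false false + W.c X * k true true
  | true, true, k => W.a X * k true true + W.d X * k false false
  | false, true, k => W.b X * k false true
  | true, false, k => W.b X * k true false

/-- The weighted sum over the ways in which a line with parameter `z`, entering in state `t` and
leaving in state `true`, crosses lines with parameters `xs` and states `bs`; the new states of
the crossed lines are passed to `k`. -/
def rowSum (W : VertexWeights) (z : ℝ) :
    List ℝ → Bool → List Bool → (List Bool → ℝ) → ℝ
  | [], t, _, k => if t then k [] else 0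
  | _ :: _, _, [], _ => 0
  | x :: xs, t, s :: bs, k =>
    vertex W (z * x) t s fun t' s' => rowSum W z xs t' bs fun l => k (s' :: l)

/-- The partition function of the triangular six-vertex model with spectral parameters `zs` and
initial states `bs`. -/
def partitionSum (W : VertexWeights) : List ℝ → List Bool → ℝ
  | [], _ => 1
  | _ :: _, [] => 0
  | z :: zs, s :: bs => rowSum W z zs s bs (partitionSum W zs)

/-- The action of the `R`-matrix that exchanges two lines. -/
def exchange (p q z₁ z₂ : ℝ) (k : Bool → Bool → ℝ) : Bool → Bool → ℝ
  | false, false => (p ^ 2 * z₁ - q ^ 2 * z₂) * k false false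
  | true, true => (p ^ 2 * z₁ - q ^ 2 * z₂) * k true true
  | false, true => (p ^ 2 - q ^ 2) * z₂ * k false true + (z₂ - z₁) * k true false
  | true, false => (z₂ - z₁) * k false true + (p ^ 2 - q ^ 2) * z₁ * k true false

theorem vertex_swap (W : VertexWeights) (X : ℝ) (t s : Bool) (k : Bool → Bool → ℝ) :
    vertex W X t s k = vertex W X s t fun t' s' => k s' t' := by
  cases t <;> cases s <;> rfl

theorem vertex_mul (W : VertexWeights) (X r : ℝ) (t s : Bool) (k : Bool → Bool → ℝ) :
    vertex W X t s (fun t' s' => r * k t' s') = r * vertex W X t s k := by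
  cases t <;> cases s <;> simp only [vertex] <;> ring

theorem rowSum_add_mul (W : VertexWeights) (z r₁ r₂ : ℝ) (xs : List ℝ) (t : Bool)
    (bs : List Bool) (k₁ k₂ : List Bool → ℝ) :
    rowSum W z xs t bs (fun l => r₁ * k₁ l + r₂ * k₂ l) =
      r₁ * rowSum W z xs t bs k₁ + r₂ * rowSum W z xs t bs k₂ := by
  induction xs generalizing t bs k₁ k₂ with
  | nil => cases t <;> simp [rowSum]
  | cons x xs ih =>
    cases bs with
    | nil => simp [rowSum]
    | cons s bs =>
      cases t <;> cases s <;> simp only [rowSum, vertex, ih] <;> ring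

theorem rowSum_mul (W : VertexWeights) (z r : ℝ) (xs : List ℝ) (t : Bool)
    (bs : List Bool) (k : List Bool → ℝ) :
    rowSum W z xs t bs (fun l => r * k l) = r * rowSum W z xs t bs k := by
  simpa using rowSum_add_mul W z r 0 xs t bs k k

theorem exchange_rowSum (p q z₁ z₂ : ℝ) (W : VertexWeights) (z : ℝ) (xs : List ℝ) (t : Bool)
    (bs : List Bool) (k : Bool → Bool → List Bool → ℝ) (s₁ s₂ : Bool) :
    exchange p q z₁ z₂ (fun u₁ u₂ => rowSum W z xs t bs (k u₁ u₂)) s₁ s₂ =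
      rowSum W z xs t bs (fun l => exchange p q z₁ z₂ (fun u₁ u₂ => k u₁ u₂ l) s₁ s₂) := by
  cases s₁ <;> cases s₂ <;> simp only [exchange, rowSum_mul, rowSum_add_mul]

theorem exchange_vertex (p q z₁ z₂ : ℝ) (W : VertexWeights) (X : ℝ) (t s : Bool)
    (k : Bool → Bool → Bool → Bool → ℝ) (s₁ s₂ : Bool) :
    exchange p q z₁ z₂ (fun u₁ u₂ => vertex W X t s (k u₁ u₂)) s₁ s₂ =
      vertex W X t s
        (fun t' s' => exchange p q z₁ z₂ (fun u₁ u₂ => k u₁ u₂ t' s') s₁ s₂) := by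
  cases s₁ <;> cases s₂ <;> cases t <;> cases s <;> simp only [exchange, vertex] <;> ring

/-- The Yang–Baxter equation. -/
theorem yang_baxter {p q : ℝ} (h : p * q = 1) (e z₁ z₂ x : ℝ) (s : Bool)
    (k : Bool → Bool → Bool → ℝ) (t₁ t₂ : Bool) :
    exchange p q z₁ z₂ (fun u₁ u₂ =>
        vertex (trigWeights p q e) (z₂ * x) u₁ s fun v₁ s' =>
          vertex (trigWeights p q e) (z₁ * x) u₂ s' fun v₂ s'' => k v₁ v₂ s'') t₁ t₂ =
      vertex (trigWeights p q e) (z₁ * x) t₁ s fun v₁ s' =>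
        vertex (trigWeights p q e) (z₂ * x) t₂ s' fun v₂ s'' =>
          exchange p q z₁ z₂ (fun u₁ u₂ => k u₁ u₂ s'') v₁ v₂ := by
  have hq : q ≠ 0 := right_ne_zero_of_mul_eq_one h
  obtain rfl : p = q⁻¹ := eq_inv_of_mul_eq_one_left h
  cases s <;> cases t₁ <;> cases t₂ <;>
    simp only [exchange, vertex, trigWeights] <;> field_simp <;> ring

theorem exchange_two_rows {p q : ℝ} (h : p * q = 1) (e z₁ z₂ : ℝ) (xs : List ℝ)
    (bs : List Bool) (k : List Bool → ℝ) (t₁ t₂ : Bool) :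
    exchange p q z₁ z₂ (fun u₁ u₂ => rowSum (trigWeights p q e) z₂ xs u₁ bs
        fun l => rowSum (trigWeights p q e) z₁ xs u₂ l k) t₁ t₂ =
      (p ^ 2 * z₁ - q ^ 2 * z₂) * rowSum (trigWeights p q e) z₁ xs t₁ bs
        fun l => rowSum (trigWeights p q e) z₂ xs t₂ l k := by
  induction xs generalizing bs k t₁ t₂ with
  | nil => cases t₁ <;> cases t₂ <;> simp [rowSum, exchange]
  | cons x xs ih =>
    cases bs with
    | nil => cases t₁ <;> cases t₂ <;> simp [rowSum, exchange]
    | cons s bs =>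
      have hrow (z z' : ℝ) (t t' : Bool) :
          rowSum (trigWeights p q e) z (x :: xs) t (s :: bs)
            (fun l => rowSum (trigWeights p q e) z' (x :: xs) t' l k) =
          vertex (trigWeights p q e) (z * x) t s fun v s' =>
            vertex (trigWeights p q e) (z' * x) t' s' fun v' s'' =>
              rowSum (trigWeights p q e) z xs v bs fun l =>
                rowSum (trigWeights p q e) z' xs v' l fun l' => k (s'' :: l') := by
        cases t <;> cases s <;> cases t' <;>
          simp only [rowSum, vertex, rowSum_mul, rowSum_add_mul]
      simp only [hrow, yang_baxter h, ih, vertex_mul]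

theorem exchange_columns {p q : ℝ} (h : p * q = 1) (e z z₁ z₂ : ℝ) (ls xs : List ℝ)
    {k k' : List Bool → ℝ}
    (hk : ∀ bl : List Bool, bl.length = ls.length → ∀ bs s₁ s₂,
      exchange p q z₁ z₂ (fun u₁ u₂ => k' (bl ++ u₁ :: u₂ :: bs)) s₁ s₂ =
        (p ^ 2 * z₁ - q ^ 2 * z₂) * k (bl ++ s₁ :: s₂ :: bs))
    (t : Bool) {bl : List Bool} (hbl : bl.length = ls.length) (bs : List Bool) (s₁ s₂ : Bool) :
    exchange p q z₁ z₂ (fun u₁ u₂ => rowSum (trigWeights p q e) z (ls ++ z₂ :: z₁ :: xs) t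
        (bl ++ u₁ :: u₂ :: bs) k') s₁ s₂ =
      (p ^ 2 * z₁ - q ^ 2 * z₂) * rowSum (trigWeights p q e) z (ls ++ z₁ :: z₂ :: xs) t
        (bl ++ s₁ :: s₂ :: bs) k := by
  induction ls generalizing bl t k k' with
  | nil =>
    obtain rfl := List.length_eq_zero_iff.1 hbl
    simp only [List.nil_append, rowSum] at hk ⊢
    have hv (x : ℝ) (t s : Bool) (f : Bool → Bool → ℝ) :
        vertex (trigWeights p q e) (z * x) t s f =
          vertex (trigWeights p q e) (x * z) s t fun s' t' => f t' s' := by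
      rw [vertex_swap, mul_comm]
    simp only [hv]
    rw [yang_baxter h]
    simp only [exchange_rowSum]
    have hk' := hk [] rfl
    simp only [List.nil_append] at hk'
    simp only [hk', rowSum_mul, vertex_mul]
  | cons x ls ih =>
    cases bl with
    | nil => simp at hbl
    | cons b bl =>
      simp only [List.cons_append, rowSum, exchange_vertex]
      rw [← vertex_mul]
      congr 1
      funext t' s'
      refine ih (fun bl' hbl' bs s₁ s₂ => ?_) t' (by simpa using hbl)
      exact hk (s' :: bl') (by simpa using hbl') bs s₁ s₂

theorem exchange_partitionSum {p q : ℝ} (h : p * q = 1) (e z₁ z₂ : ℝ) (ls xs : List ℝ)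
    {bl : List Bool} (hbl : bl.length = ls.length) (bs : List Bool) (s₁ s₂ : Bool) :
    exchange p q z₁ z₂ (fun u₁ u₂ => partitionSum (trigWeights p q e) (ls ++ z₂ :: z₁ :: xs)
        (bl ++ u₁ :: u₂ :: bs)) s₁ s₂ =
      (p ^ 2 * z₁ - q ^ 2 * z₂) * partitionSum (trigWeights p q e) (ls ++ z₁ :: z₂ :: xs)
        (bl ++ s₁ :: s₂ :: bs) := by
  induction ls generalizing bl bs s₁ s₂ with
  | nil =>
    obtain rfl := List.length_eq_zero_iff.1 hbl
    have hv (f : Bool → Bool → ℝ) : exchange p q z₁ z₂ (fun u₁ u₂ =>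
          vertex (trigWeights p q e) (z₂ * z₁) u₁ u₂ f) s₁ s₂ =
        vertex (trigWeights p q e) (z₁ * z₂) s₁ s₂ fun v₁ v₂ => exchange p q z₁ z₂ f v₁ v₂ := by
      rw [mul_comm z₂]
      cases s₁ <;> cases s₂ <;> simp only [exchange, vertex] <;> ring
    simp only [List.nil_append, partitionSum, rowSum]
    rw [hv, ← vertex_mul]
    congr 1
    funext v₁ v₂
    exact exchange_two_rows h e z₁ z₂ xs bs _ v₁ v₂
  | cons x ls ih =>
    cases bl with
    | nil => simp at hbl
    | cons b bl =>
      exact exchange_columns h e x z₁ z₂ ls xs (fun bl' hbl' => ih hbl') b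
        (by simpa using hbl) bs s₁ s₂

theorem rowSum_congr (W : VertexWeights) (z : ℝ) (xs : List ℝ) (t : Bool) (bs : List Bool)
    {k k' : List Bool → ℝ} (h : ∀ l, l.length = xs.length → k l = k' l) :
    rowSum W z xs t bs k = rowSum W z xs t bs k' := by
  induction xs generalizing t bs k k' with
  | nil => simp [rowSum, h []]
  | cons x xs ih =>
    cases bs with
    | nil => rfl
    | cons s bs =>
      simp only [rowSum]
      congr 1
      funext t' s'
      exact ih _ _ fun l hl => h _ (by simp [hl])

/-- The partition function with all initial states `false`. -/
def domainWall (W : VertexWeights) (zs : List ℝ) : ℝ :=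
  partitionSum W zs (List.replicate zs.length false)

theorem domainWall_append_perm {p q : ℝ} (h : p * q = 1) (e : ℝ) {l l' : List ℝ}
    (hl : l.Perm l') (hgen : ∀ x ∈ l, ∀ y ∈ l, p ^ 2 * x ≠ q ^ 2 * y) (ls : List ℝ) :
    domainWall (trigWeights p q e) (ls ++ l) = domainWall (trigWeights p q e) (ls ++ l') := by
  induction hl generalizing ls with
  | nil => rfl
  | cons x _ ih =>
    simpa using ih (fun y hy w hw => hgen y (by simp [hy]) w (by simp [hw])) (ls ++ [x])
  | swap x y l =>
    have key := exchange_partitionSum h e x y ls l (List.length_replicate (a := false))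
      (List.replicate l.length false) false false
    have hr := sub_ne_zero.2 (hgen x (by simp) y (by simp))
    have hrep : List.replicate (ls.length + (l.length + 1 + 1)) false =
        List.replicate ls.length false ++ false :: false :: List.replicate l.length false := by
      rw [← List.replicate_append_replicate, List.replicate_succ, List.replicate_succ]
    simpa [exchange, domainWall, hrep, hr] using key
  | trans h₁ _ ih₁ ih₂ =>
    exact (ih₁ hgen ls).trans
      (ih₂ (fun y hy w hw => hgen y (h₁.mem_iff.2 hy) w (h₁.mem_iff.2 hw)) ls)

theorem rowSum_true_replicate (W : VertexWeights) (z : ℝ) (xs : List ℝ)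
    (k : List Bool → ℝ) :
    rowSum W z xs true (List.replicate xs.length false) k =
      (xs.map fun x => W.b (z * x)).prod * k (List.replicate xs.length false) := by
  induction xs generalizing k with
  | nil => simp [rowSum]
  | cons x xs ih => simp [rowSum, vertex, List.replicate_succ, ih, mul_assoc]

/-- If the first vertex of the first row cannot be of type `a`, then the first row and the second
row are frozen. -/
theorem domainWall_cons_cons (W : VertexWeights) (z x : ℝ) (xs : List ℝ)
    (h : W.a (z * x) = 0) :
    domainWall W (z :: x :: xs) = W.c (z * x) * (xs.map fun y => W.b (z * y)).prod *
      (xs.map fun y => W.b (x * y)).prod * domainWall W xs := by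
  simp only [domainWall, partitionSum, List.length_cons, List.replicate_succ, rowSum, vertex, h,
    rowSum_true_replicate]
  ring

theorem rowSum_append_singleton (W : VertexWeights) (z x : ℝ) (xs : List ℝ)
    (h : W.b (z * x) = 0) (k : List Bool → ℝ) :
    rowSum W z (xs ++ [x]) false (List.replicate (xs ++ [x]).length false) k =
      W.c (z * x) * (xs.map fun y => W.a (z * y)).prod *
        k (List.replicate xs.length false ++ [true]) := by
  induction xs generalizing k with
  | nil => simp [rowSum, vertex]
  | cons y xs ih =>
    simp only [List.cons_append, List.length_cons, List.replicate_succ, rowSum, vertex, ih,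
      rowSum_true_replicate]
    simp [h]
    ring

theorem rowSum_append_true (W : VertexWeights) (z x : ℝ) (xs : List ℝ) (t : Bool)
    {bs : List Bool} (hbs : bs.length = xs.length) (k : List Bool → ℝ) :
    rowSum W z (xs ++ [x]) t (bs ++ [true]) k =
      W.a (z * x) * rowSum W z xs t bs fun l => k (l ++ [true]) := by
  induction xs generalizing t bs k with
  | nil =>
    obtain rfl := List.length_eq_zero_iff.1 hbs
    cases t <;> simp [rowSum, vertex]
  | cons y xs ih =>
    cases bs with
    | nil => simp at hbs
    | cons s bs =>
      simp only [List.cons_append, rowSum]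
      rw [← vertex_mul]
      congr 1
      funext t' s'
      exact ih t' (by simpa using hbs) _

theorem partitionSum_append_true (W : VertexWeights) (x : ℝ) (xs : List ℝ)
    {bs : List Bool} (hbs : bs.length = xs.length) :
    partitionSum W (xs ++ [x]) (bs ++ [true]) =
      (xs.map fun y => W.a (y * x)).prod * partitionSum W xs bs := by
  induction xs generalizing bs with
  | nil =>
    obtain rfl := List.length_eq_zero_iff.1 hbs
    simp [partitionSum, rowSum]
  | cons y xs ih =>
    cases bs with
    | nil => simp at hbs
    | cons s bs =>
      simp only [List.cons_append, partitionSum]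
      rw [rowSum_append_true W y x xs s (by simpa using hbs),
        rowSum_congr W y xs s bs fun l hl => ih hl, rowSum_mul]
      simp [mul_assoc]

/-- If the last vertex of the first row cannot be of type `b`, then the first row and the last
column are frozen. -/
theorem domainWall_cons_append (W : VertexWeights) (z x : ℝ) (xs : List ℝ)
    (h : W.b (z * x) = 0) :
    domainWall W (z :: (xs ++ [x])) = W.c (z * x) * (xs.map fun y => W.a (z * y)).prod *
      (xs.map fun y => W.a (y * x)).prod * domainWall W xs := by
  simp only [domainWall, partitionSum, List.length_cons, List.replicate_succ,
    rowSum_append_singleton W z x xs h]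
  rw [partitionSum_append_true W x xs (by simp)]
  ring

theorem degree_list_prod_linear_le {ι : Type*} (l : List ι) (f g : ι → ℝ) :
    (l.map fun i => Polynomial.C (f i) * Polynomial.X + Polynomial.C (g i)).prod.degree ≤
      (l.length : WithBot ℕ) := by
  induction l with
  | nil => simp
  | cons i l ih =>
    rw [List.map_cons, List.prod_cons]
    refine (Polynomial.degree_mul_le_of_le Polynomial.degree_linear_le ih).trans ?_
    simp [add_comm]

theorem exists_rowSum_eq_eval (p q e : ℝ) (xs : List ℝ) (k : List Bool → ℝ) :
    ∃ P : Polynomial ℝ, P.degree < xs.length ∧ ∀ z,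
      rowSum (trigWeights p q e) z xs false (List.replicate xs.length false) k = P.eval z := by
  induction xs generalizing k with
  | nil => exact ⟨0, by simp, fun z => by simp [rowSum]⟩
  | cons x xs ih =>
    obtain ⟨P, hP, hPe⟩ := ih fun l => k (false :: l)
    refine ⟨(Polynomial.C (e * p * x) * Polynomial.X + Polynomial.C (-(e * q))) * P +
      Polynomial.C (e * (p ^ 2 - q ^ 2) * k (true :: List.replicate xs.length false)) *
        (xs.map fun y => Polynomial.C (-(e * q * y)) * Polynomial.X +
          Polynomial.C (e * p)).prod, ?_, fun z => ?_⟩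
    · have hlin (a b : ℝ) : (Polynomial.C a * Polynomial.X + Polynomial.C b).degree ≤ 1 :=
        Polynomial.degree_linear_le
      refine (Polynomial.degree_add_le _ _).trans_lt (max_lt ?_ ?_)
      · by_cases hP0 : P = 0
        · simp [hP0]
        · rw [Polynomial.degree_eq_natDegree hP0] at hP
          refine (Polynomial.degree_mul_le_of_le (hlin _ _) le_rfl).trans_lt ?_
          rw [Polynomial.degree_eq_natDegree hP0]
          have : P.natDegree < xs.length := by exact_mod_cast hP
          simp only [List.length_cons]
          exact_mod_cast (by omega : 1 + P.natDegree < xs.length + 1)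
      · refine (Polynomial.degree_mul_le_of_le Polynomial.degree_C_le
          (degree_list_prod_linear_le xs _ _)).trans_lt ?_
        simp only [List.length_cons, zero_add]
        exact_mod_cast Nat.lt_succ_self _
    · have hb : (fun y => (trigWeights p q e).b (z * y)) = fun y =>
          (Polynomial.C (-(e * q * y)) * Polynomial.X + Polynomial.C (e * p)).eval z := by
        funext y
        simp [trigWeights]
        ring
      simp only [List.length_cons, List.replicate_succ, rowSum, vertex, hPe,
        rowSum_true_replicate, hb, Polynomial.eval_add, Polynomial.eval_mul,
        Polynomial.eval_list_prod, List.map_map]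
      simp [trigWeights, Function.comp_def]
      ring

theorem domainWall_swap_of_generic {p q : ℝ} (h : p * q = 1) (e : ℝ) (n : ℕ) {xs : List ℝ}
    (hlen : xs.length = 2 * n + 1) (hnd : xs.Nodup) (h0 : ∀ x ∈ xs, x ≠ 0)
    (hgen : ∀ x ∈ xs, ∀ y ∈ xs, p ^ 2 * x ≠ q ^ 2 * y) (z : ℝ) :
    domainWall (trigWeights p q e) (z :: xs) = domainWall (trigWeights q p (-e)) (z :: xs) := by
  induction n generalizing xs z with
  | zero =>
    obtain ⟨x, rfl⟩ := List.length_eq_one_iff.1 hlen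
    simp [domainWall, partitionSum, rowSum, vertex, trigWeights]
    ring
  | succ n ih =>
    obtain ⟨P, hP, hPe⟩ := exists_rowSum_eq_eval p q e xs (partitionSum (trigWeights p q e) xs)
    obtain ⟨Q, hQ, hQe⟩ := exists_rowSum_eq_eval q p (-e) xs
      (partitionSum (trigWeights q p (-e)) xs)
    replace hPe (z : ℝ) : domainWall (trigWeights p q e) (z :: xs) = P.eval z := hPe z
    replace hQe (z : ℝ) : domainWall (trigWeights q p (-e)) (z :: xs) = Q.eval z := hQe z
    rw [hPe, hQe]
    congr 1
    have hq : q ≠ 0 := right_ne_zero_of_mul_eq_one h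
    have hcard : xs.toFinset.card = xs.length := List.toFinset_card_of_nodup hnd
    refine Polynomial.eq_of_degrees_lt_of_eval_index_eq (v := fun x : ℝ => q ^ 2 / x)
      xs.toFinset (fun x hx y hy hxy => ?_) (by rwa [hcard]) (by rwa [hcard]) fun x hx => ?_
    · have hx0 := h0 x (by simpa using hx)
      have hy0 := h0 y (by simpa using hy)
      simp only at hxy
      field_simp at hxy
      exact hxy.symm
    · rw [List.mem_toFinset] at hx
      rw [← hPe, ← hQe]
      have hperm := List.perm_cons_erase hx
      have hsub : ∀ y ∈ xs.erase x, y ∈ xs := fun y => List.mem_of_mem_erase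
      have hrec : domainWall (trigWeights p q e) (xs.erase x) =
          domainWall (trigWeights q p (-e)) (xs.erase x) := by
        have hlen' : (xs.erase x).length = 2 * n + 2 := by
          rw [List.length_erase_of_mem hx, hlen]
          omega
        obtain ⟨w, ys, hys⟩ := List.exists_cons_of_length_eq_add_one hlen'
        have hnd' := hnd.erase x
        rw [hys] at hlen' hsub hnd' ⊢
        exact ih (by simpa using hlen') (List.nodup_cons.1 hnd').2
          (fun y hy => h0 y (hsub y (by simp [hy])))
          (fun y hy u hu => hgen y (hsub y (by simp [hy])) u (hsub u (by simp [hu]))) w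
      have hx0 := h0 x hx
      have hzx : q ^ 2 / x * x = q ^ 2 := div_mul_cancel₀ _ hx0
      have hpq : p * q ^ 2 = q := by linear_combination q * h
      have hF := domainWall_append_perm h e hperm hgen [q ^ 2 / x]
      have hG := domainWall_append_perm ((mul_comm q p).trans h) (-e)
        (hperm.trans (List.perm_append_singleton x _).symm)
        (fun y hy w hw hyw => hgen w hw y hy hyw.symm) [q ^ 2 / x]
      simp only [List.singleton_append] at hF hG
      rw [hF, hG, domainWall_cons_cons _ _ _ _ (by simp [trigWeights, hzx, hpq]),
        domainWall_cons_append _ _ _ _ (by simp [trigWeights, hzx, hpq]), hrec]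
      have hab (X : ℝ) : (trigWeights q p (-e)).a X = (trigWeights p q e).b X := by
        simp only [trigWeights]
        ring
      simp only [hab, mul_comm x]
      simp only [trigWeights]
      ring

theorem continuous_rowSum (p q e : ℝ) {f : ℝ → ℝ} (hf : Continuous f) {fs : List (ℝ → ℝ)}
    (hfs : ∀ g ∈ fs, Continuous g) (t : Bool) (bs : List Bool) {k : ℝ → List Bool → ℝ}
    (hk : ∀ l, Continuous fun u => k u l) :
    Continuous fun u => rowSum (trigWeights p q e) (f u) (fs.map fun g => g u) t bs (k u) := by
  induction fs generalizing t bs k with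
  | nil => cases t <;> simp [rowSum, hk, continuous_const]
  | cons g fs ih =>
    cases bs with
    | nil => simp [rowSum, continuous_const]
    | cons s bs =>
      have hg : Continuous g := hfs g (by simp)
      have ih' (t' s' : Bool) := ih (fun g hg => hfs g (by simp [hg])) t' bs
        (k := fun u l => k u (s' :: l)) fun l => hk _
      cases t <;> cases s <;> simp only [List.map_cons, rowSum, vertex, trigWeights] <;>
        fun_prop (disch := assumption)

theorem continuous_partitionSum (p q e : ℝ) {fs : List (ℝ → ℝ)}
    (hfs : ∀ g ∈ fs, Continuous g) (bs : List Bool) :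
    Continuous fun u => partitionSum (trigWeights p q e) (fs.map fun g => g u) bs := by
  induction fs generalizing bs with
  | nil => simp [partitionSum, continuous_const]
  | cons g fs ih =>
    cases bs with
    | nil => simp [partitionSum, continuous_const]
    | cons s bs =>
      exact continuous_rowSum p q e (hfs g (by simp)) (fun g hg => hfs g (by simp [hg])) s bs
        (ih fun g hg => hfs g (by simp [hg]))

theorem domainWall_swap_replicate_one {p q : ℝ} (h : p * q = 1) (hp : 1 < p) (e : ℝ) (n : ℕ)
    (z : ℝ) :
    domainWall (trigWeights p q e) (z :: List.replicate (2 * n + 1) 1) =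
      domainWall (trigWeights q p (-e)) (z :: List.replicate (2 * n + 1) 1) := by
  let fs : List (ℝ → ℝ) := (fun _ => z) :: (List.range (2 * n + 1)).map fun (i : ℕ) u => 1 + i * u
  have hfs : ∀ g ∈ fs, Continuous g := by
    simp only [fs, List.mem_cons, List.mem_map]
    rintro g (rfl | ⟨i, -, rfl⟩) <;> fun_prop
  have heval (u : ℝ) : fs.map (fun g => g u) =
      z :: (List.range (2 * n + 1)).map fun i : ℕ => 1 + (i : ℝ) * u := by
    simp [fs, Function.comp_def]
  have hlim (p q e : ℝ) : Filter.Tendsto (fun u : ℝ => domainWall (trigWeights p q e)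
      (z :: (List.range (2 * n + 1)).map fun i : ℕ => 1 + (i : ℝ) * u)) (nhdsWithin 0 (Set.Ioi 0))
      (nhds (domainWall (trigWeights p q e) (z :: List.replicate (2 * n + 1) 1))) := by
    have := ((continuous_partitionSum p q e hfs
      (List.replicate (2 * n + 2) false)).tendsto 0).mono_left
        (nhdsWithin_le_nhds (s := Set.Ioi 0))
    simpa [heval, domainWall] using this
  refine tendsto_nhds_unique_of_eventuallyEq (hlim p q e) (hlim q p (-e)) ?_
  have hq : 0 < q := (pos_iff_pos_of_mul_pos (h ▸ one_pos)).1 (one_pos.trans hp)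
  have hq1 : q < p := by nlinarith
  have hsmall : ∀ᶠ u : ℝ in nhdsWithin 0 (Set.Ioi 0), q ^ 2 * (1 + (2 * n + 1) * u) < p ^ 2 := by
    refine nhdsWithin_le_nhds (Continuous.tendsto (by fun_prop) 0 |>.eventually_lt_const ?_)
    simp only [mul_zero, add_zero, mul_one]
    exact pow_lt_pow_left₀ hq1 hq.le two_ne_zero
  filter_upwards [hsmall, self_mem_nhdsWithin] with u hu hu0
  rw [Set.mem_Ioi] at hu0
  refine domainWall_swap_of_generic h e n (by simp) ?_ ?_ ?_ z
  · refine List.nodup_range.map fun i j hij => ?_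
    simpa [hu0.ne'] using hij
  · simp only [List.mem_map]
    rintro _ ⟨i, -, rfl⟩
    positivity
  · simp only [List.mem_map, List.mem_range]
    rintro _ ⟨i, -, rfl⟩ _ ⟨j, hj, rfl⟩
    have hj' : (j : ℝ) ≤ 2 * n + 1 := by exact_mod_cast hj.le
    have h1 : q ^ 2 * (1 + j * u) ≤ q ^ 2 * (1 + (2 * n + 1) * u) := by gcongr
    have h2 : p ^ 2 * 1 ≤ p ^ 2 * (1 + i * u) := by
      gcongr
      simp only [le_add_iff_nonneg_right]
      positivity
    linarith

/-- A row of a partial alternating sign matrix whose partial sums start at `t`: all of them lie in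
`{0, 1}`, and the last one is `1`. -/
def IsPartialRow {m : ℕ} (t : ℤ) (r : Fin m → ℤ) : Prop :=
  (∀ k, t + ∑ j ∈ univ.filter (fun j => j ≤ k), r j = 0 ∨
    t + ∑ j ∈ univ.filter (fun j => j ≤ k), r j = 1) ∧ t + ∑ j, r j = 1

instance {m : ℕ} (t : ℤ) (r : Fin m → ℤ) : Decidable (IsPartialRow t r) :=
  inferInstanceAs (Decidable (_ ∧ _))

theorem sum_filter_le_succ {M : Type*} [AddCommMonoid M] {m : ℕ} (f : Fin (m + 1) → M)
    (k : Fin m) :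
    ∑ j ∈ univ.filter (fun j => j ≤ k.succ), f j =
      f 0 + ∑ j ∈ univ.filter (fun j => j ≤ k), f j.succ := by
  simp [sum_filter, Fin.sum_univ_succ]

theorem isPartialRow_succ {m : ℕ} {t : ℤ} {r : Fin (m + 1) → ℤ} :
    IsPartialRow t r ↔
      (t + r 0 = 0 ∨ t + r 0 = 1) ∧ IsPartialRow (t + r 0) fun j => r j.succ := by
  have h0 : ∑ j ∈ univ.filter (fun j : Fin (m + 1) => j ≤ 0), r j = r 0 := by
    simp [sum_filter]
  simp only [IsPartialRow, Fin.forall_fin_succ, h0, sum_filter_le_succ, Fin.sum_univ_succ,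
    and_assoc, add_assoc]

theorem IsPartialRow.entry {m : ℕ} {t : ℤ} {r : Fin m → ℤ} (ht : t = 0 ∨ t = 1)
    (h : IsPartialRow t r) (j : Fin m) : r j = -1 ∨ r j = 0 ∨ r j = 1 := by
  induction m generalizing t with
  | zero => exact j.elim0
  | succ m ih =>
    rw [isPartialRow_succ] at h
    refine Fin.cases ?_ (fun j => ?_) j
    · omega
    · exact ih h.1 h.2 j

/-- The lower right block of an even-order OSASM, where `s i` is the sum of the entries of its
`i`-th row outside of the block. -/
def IsPartialOSASM {m : ℕ} (s : Fin m → ℤ) (B : Matrix (Fin m) (Fin m) ℤ) : Prop :=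
  B.IsSymm ∧ (∀ i, B i i = 0) ∧ ∀ i, IsPartialRow (s i) (B i)

theorem isOSASMeven_iff {m : ℕ} {A : Matrix (Fin m) (Fin m) ℤ} :
    IsOSASMeven A ↔ IsPartialOSASM 0 A := by
  constructor
  · rintro ⟨⟨⟨-, h₁, -, h₂, -⟩, hs⟩, hd⟩
    exact ⟨hs, hd, fun i => ⟨by simpa using h₁ i, by simpa using h₂ i⟩⟩
  · rintro ⟨hs, hd, hr⟩
    have h₁ (i k : Fin m) : (∑ j ∈ univ.filter (fun j => j ≤ k), A i j) = 0 ∨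
        (∑ j ∈ univ.filter (fun j => j ≤ k), A i j) = 1 := by simpa using (hr i).1 k
    have h₂ (i : Fin m) : ∑ j, A i j = 1 := by simpa using (hr i).2
    refine ⟨⟨⟨fun i j => (hr i).entry (.inl rfl) j, h₁, fun j k => ?_, h₂, fun j => ?_⟩, hs⟩, hd⟩
    · simpa only [hs.apply] using h₁ j k
    · simpa only [hs.apply] using h₂ j

theorem finite_isPartialOSASM {m : ℕ} {s : Fin m → ℤ} (hs : ∀ i, s i = 0 ∨ s i = 1) :
    {B | IsPartialOSASM s B}.Finite := by
  refine (Set.Finite.pi' fun _ : Fin m => Set.Finite.pi' fun _ : Fin m =>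
    Set.finite_Icc (-1 : ℤ) 1).subset fun B hB i j => ?_
  rw [Set.mem_Icc]
  have := (hB.2.2 i).entry (hs i) j
  omega

/-- The symmetric matrix with first row `(0, r)` and lower right block `B`. -/
def border {m : ℕ} (r : Fin m → ℤ) (B : Matrix (Fin m) (Fin m) ℤ) :
    Matrix (Fin (m + 1)) (Fin (m + 1)) ℤ :=
  Matrix.of (Fin.cons (Fin.cons 0 r) fun i => Fin.cons (r i) (B i))

@[simp]
theorem border_zero_zero {m : ℕ} (r : Fin m → ℤ) (B : Matrix (Fin m) (Fin m) ℤ) :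
    border r B 0 0 = 0 := rfl

@[simp]
theorem border_zero_succ {m : ℕ} (r : Fin m → ℤ) (B : Matrix (Fin m) (Fin m) ℤ) (j : Fin m) :
    border r B 0 j.succ = r j := rfl

@[simp]
theorem border_succ_zero {m : ℕ} (r : Fin m → ℤ) (B : Matrix (Fin m) (Fin m) ℤ) (i : Fin m) :
    border r B i.succ 0 = r i := rfl

@[simp]
theorem border_succ_succ {m : ℕ} (r : Fin m → ℤ) (B : Matrix (Fin m) (Fin m) ℤ) (i j : Fin m) :
    border r B i.succ j.succ = B i j := rfl

theorem isPartialOSASM_border {m : ℕ} {s : Fin (m + 1) → ℤ} {r : Fin m → ℤ}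
    {B : Matrix (Fin m) (Fin m) ℤ} :
    IsPartialOSASM s (border r B) ↔ (s 0 = 0 ∨ s 0 = 1) ∧ IsPartialRow (s 0) r ∧
      (∀ i, s i.succ + r i = 0 ∨ s i.succ + r i = 1) ∧
      IsPartialOSASM (fun i => s i.succ + r i) B := by
  have hsymm : (border r B).IsSymm ↔ B.IsSymm := by
    rw [Matrix.IsSymm.ext_iff, Matrix.IsSymm.ext_iff]
    simp [Fin.forall_fin_succ]
  simp only [IsPartialOSASM, hsymm]
  simp only [Fin.forall_fin_succ, isPartialRow_succ, border_zero_zero,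
    border_zero_succ, border_succ_zero, border_succ_succ, add_zero, forall_and]
  tauto

theorem IsPartialOSASM.eq_border {m : ℕ} {s : Fin (m + 1) → ℤ}
    {B : Matrix (Fin (m + 1)) (Fin (m + 1)) ℤ} (h : IsPartialOSASM s B) :
    B = border (fun i => B 0 i.succ) (B.submatrix Fin.succ Fin.succ) := by
  ext i j
  refine Fin.cases (Fin.cases ?_ (fun j => ?_) j) (fun i => Fin.cases ?_ (fun j => ?_) j) i
  · simp [h.2.1 0]
  · simp
  · simp [h.1.apply 0]
  · simp

theorem Rstat_border {m : ℕ} (r : Fin m → ℤ) (B : Matrix (Fin m) (Fin m) ℤ) :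
    Rstat (border r B) = ∑ i, (r i).natAbs + Rstat B := by
  simp [Rstat, sum_filter, Fintype.sum_prod_type, Fin.sum_univ_succ]

/-- The value of a state as an integer. -/
def stateValue (b : Bool) : ℤ := if b then 1 else 0

theorem stateValue_eq (b : Bool) : stateValue b = 0 ∨ stateValue b = 1 := by
  cases b <;> simp [stateValue]

/-- The partial OSASMs with initial states `s`. -/
noncomputable def partialOSASMs {m : ℕ} (s : Fin m → Bool) :
    Finset (Matrix (Fin m) (Fin m) ℤ) :=
  (finite_isPartialOSASM fun i => stateValue_eq (s i)).toFinset

theorem mem_partialOSASMs {m : ℕ} {s : Fin m → Bool} {B : Matrix (Fin m) (Fin m) ℤ} :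
    B ∈ partialOSASMs s ↔ IsPartialOSASM (fun i => stateValue (s i)) B := by
  simp [partialOSASMs]

/-- The generating function of partial OSASMs by the statistic `Rstat`. -/
noncomputable def partialGF (y : ℝ) {m : ℕ} (s : Fin m → Bool) : ℝ :=
  ∑ B ∈ partialOSASMs s, y ^ Rstat B

/-- The weight of a row, given the states of the columns before and after it. -/
noncomputable def rowWeight (y : ℝ) (t : Bool) {m : ℕ} (s s' : Fin m → Bool) : ℝ :=
  if IsPartialRow (stateValue t) (fun i => stateValue (s' i) - stateValue (s i)) then
    y ^ ∑ i, (stateValue (s' i) - stateValue (s i)).natAbs else 0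

/-- The states of the columns after the first row of `B`, when they are `s` before it. -/
def statesAfter {m : ℕ} (s : Fin (m + 1) → Bool) (B : Matrix (Fin (m + 1)) (Fin (m + 1)) ℤ) :
    Fin m → Bool :=
  fun i => decide (stateValue (s i.succ) + B 0 i.succ = 1)

theorem statesAfter_border {m : ℕ} (s : Fin (m + 1) → Bool) (s' : Fin m → Bool)
    (B : Matrix (Fin m) (Fin m) ℤ) :
    statesAfter s (border (fun i => stateValue (s' i) - stateValue (s i.succ)) B) = s' := by
  funext i
  cases h : s' i <;> simp [statesAfter, stateValue, h]

theorem stateValue_statesAfter {m : ℕ} {s : Fin (m + 1) → Bool}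
    {B : Matrix (Fin (m + 1)) (Fin (m + 1)) ℤ} (hB : B ∈ partialOSASMs s) (i : Fin m) :
    stateValue (statesAfter s B i) - stateValue (s i.succ) = B 0 i.succ := by
  rw [mem_partialOSASMs] at hB
  have h := hB
  rw [hB.eq_border, isPartialOSASM_border] at h
  rw [statesAfter]
  obtain h | h := h.2.2.1 i
  · rw [h]
    change (0 : ℤ) - _ = _
    omega
  · rw [h]
    change (1 : ℤ) - _ = _
    omega

theorem sum_statesAfter_eq (y : ℝ) {m : ℕ} (s : Fin (m + 1) → Bool) (s' : Fin m → Bool) :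
    ∑ B ∈ (partialOSASMs s).filter (fun B => statesAfter s B = s'), y ^ Rstat B =
      rowWeight y (s 0) (fun i => s i.succ) s' * partialGF y s' := by
  have key (B : Matrix (Fin m) (Fin m) ℤ) :
      border (fun i => stateValue (s' i) - stateValue (s i.succ)) B ∈ partialOSASMs s ↔
        IsPartialRow (stateValue (s 0)) (fun i => stateValue (s' i) - stateValue (s i.succ)) ∧
          B ∈ partialOSASMs s' := by
    simp [mem_partialOSASMs, isPartialOSASM_border, stateValue_eq]
  have hborder {B : Matrix (Fin (m + 1)) (Fin (m + 1)) ℤ} (hB : B ∈ partialOSASMs s)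
      (hs : statesAfter s B = s') :
      border (fun i => stateValue (s' i) - stateValue (s i.succ))
        (B.submatrix Fin.succ Fin.succ) = B := by
    subst hs
    simp only [stateValue_statesAfter hB]
    exact (mem_partialOSASMs.1 hB).eq_border.symm
  rw [rowWeight]
  split_ifs with hrow
  · rw [partialGF, mul_sum]
    refine (sum_nbij' (border fun i => stateValue (s' i) - stateValue (s i.succ))
      (fun B => B.submatrix Fin.succ Fin.succ) (fun B hB => ?_) (fun B hB => ?_) (fun B _ => ?_)
      (fun B hB => ?_) fun B _ => ?_).symm
    · exact mem_filter.2 ⟨(key B).2 ⟨hrow, hB⟩, statesAfter_border s s' B⟩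
    · obtain ⟨hB, hs⟩ := mem_filter.1 hB
      rw [← hborder hB hs] at hB
      exact ((key _).1 hB).2
    · ext i j
      simp
    · exact hborder (mem_filter.1 hB).1 (mem_filter.1 hB).2
    · rw [Rstat_border, pow_add]
  · rw [zero_mul]
    refine sum_eq_zero fun B hB => ?_
    obtain ⟨hB, hs⟩ := mem_filter.1 hB
    rw [← hborder hB hs] at hB
    exact absurd ((key _).1 hB).1 hrow

theorem partialGF_succ (y : ℝ) {m : ℕ} (s : Fin (m + 1) → Bool) :
    partialGF y s = ∑ s', rowWeight y (s 0) (fun i => s i.succ) s' * partialGF y s' := by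
  simp only [← sum_statesAfter_eq]
  exact (sum_fiberwise _ _ _).symm

theorem sum_fun_fin_succ {M : Type*} [AddCommMonoid M] {m : ℕ} (f : (Fin (m + 1) → Bool) → M) :
    ∑ s, f s = ∑ b, ∑ s : Fin m → Bool, f (Fin.cons b s) := by
  rw [← (Fin.consEquiv fun _ : Fin (m + 1) => Bool).sum_comp, Fintype.sum_prod_type]
  rfl

theorem rowWeight_cons (y : ℝ) (t : Bool) {m : ℕ} (s : Fin (m + 1) → Bool) (b : Bool)
    (s' : Fin m → Bool) :
    rowWeight y t s (Fin.cons b s') =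
      vertex ⟨1, 1, fun _ => y, fun _ => y⟩ 1 t (s 0) fun t' b' =>
        if b' = b then rowWeight y t' (fun i => s i.succ) s' else 0 := by
  simp only [rowWeight, isPartialRow_succ (m := m)]
  cases t <;> cases b <;> cases hs : s 0 <;>
    simp [Fin.sum_univ_succ, vertex, stateValue, hs, pow_add]

theorem rowSum_replicate_one {W : VertexWeights} {y : ℝ} (ha : W.a 1 = 1) (hb : W.b 1 = 1)
    (hc : W.c 1 = y) (hd : W.d 1 = y) {m : ℕ} (t : Bool) (s : Fin m → Bool)
    (k : List Bool → ℝ) :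
    rowSum W 1 (List.replicate m 1) t (List.ofFn s) k =
      ∑ s' : Fin m → Bool, rowWeight y t s s' * k (List.ofFn s') := by
  induction m generalizing t k with
  | zero => cases t <;> simp [rowSum, rowWeight, IsPartialRow, stateValue]
  | succ m ih =>
    rw [sum_fun_fin_succ]
    simp only [List.replicate_succ, List.ofFn_succ, rowSum, ih, Fintype.sum_bool,
      rowWeight_cons, Fin.cons_zero, Fin.cons_succ]
    cases t <;> cases s 0 <;>
      simp [vertex, ha, hb, hc, hd, mul_sum, mul_assoc, add_comm]

theorem partitionSum_replicate_one {W : VertexWeights} {y : ℝ} (ha : W.a 1 = 1)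
    (hb : W.b 1 = 1) (hc : W.c 1 = y) (hd : W.d 1 = y) {m : ℕ} (s : Fin m → Bool) :
    partitionSum W (List.replicate m 1) (List.ofFn s) = partialGF y s := by
  induction m with
  | zero =>
    have : (partialOSASMs s) = {0} := by
      ext B
      simp [mem_partialOSASMs, IsPartialOSASM, Subsingleton.elim B 0]
    simp [partitionSum, partialGF, this, Rstat]
  | succ m ih =>
    rw [partialGF_succ, List.replicate_succ, List.ofFn_succ, partitionSum,
      rowSum_replicate_one ha hb hc hd]
    simp only [ih]

/-- The states in which only the line `j` is in state `true`. -/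
def singleState {m : ℕ} (j : Fin m) : Fin m → Bool := fun i => decide (i = j)

theorem rowSum_false_replicate (W : VertexWeights) (z : ℝ) (m : ℕ) (k : List Bool → ℝ) :
    rowSum W z (List.replicate m 1) false (List.replicate m false) k =
      ∑ j : Fin m, W.c z * W.a z ^ (j : ℕ) * W.b z ^ (m - 1 - j) *
        k (List.ofFn (singleState j)) := by
  induction m generalizing k with
  | zero => simp [rowSum]
  | succ m ih =>
    have h := rowSum_true_replicate W z (List.replicate m 1) fun l => k (true :: l)
    simp only [List.length_replicate, List.map_replicate, List.prod_replicate, mul_one] at h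
    have h0 : List.ofFn (singleState (0 : Fin (m + 1))) = true :: List.replicate m false := by
      simp [List.ofFn_succ, singleState, Fin.succ_ne_zero]
    have hs (j : Fin m) :
        List.ofFn (singleState j.succ) = false :: List.ofFn (singleState j) := by
      simp [List.ofFn_succ, singleState, (Fin.succ_ne_zero j).symm, funext_iff]
    simp only [List.replicate_succ, rowSum, vertex, mul_one, ih, h, Fin.sum_univ_succ, h0, hs,
      mul_sum]
    rw [add_comm]
    congr 1
    · simp [mul_assoc]
    · refine sum_congr rfl fun j _ => ?_
      rw [Fin.val_succ, show m + 1 - 1 - ((j : ℕ) + 1) = m - 1 - j by omega]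
      ring

theorem partialGF_singleState_rev {p : ℝ} (hp : 1 < p) (n : ℕ) (j : Fin (2 * n + 1)) :
    partialGF (p + p⁻¹) (singleState j.rev) = partialGF (p + p⁻¹) (singleState j) := by
  obtain ⟨q, hq⟩ : ∃ q, q = p⁻¹ := ⟨_, rfl⟩
  rw [← hq]
  have hp0 : 0 < p := one_pos.trans hp
  have hq0 : 0 < q := by rw [hq]; positivity
  have h : p * q = 1 := by rw [hq, mul_inv_cancel₀ hp0.ne']
  have hqp : q < p := by nlinarith
  have hpq0 : p - q ≠ 0 := (sub_pos.2 hqp).ne'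
  have hgf (p q : ℝ) (h : p - q ≠ 0) (s : Fin (2 * n + 1) → Bool) :
      partitionSum (trigWeights p q (p - q)⁻¹) (List.replicate (2 * n + 1) 1) (List.ofFn s) =
        partialGF (p + q) s := by
    apply partitionSum_replicate_one <;> simp only [trigWeights] <;> field_simp
    · ring
    · ring
  have hDW (p q : ℝ) (h : p - q ≠ 0) (z : ℝ) : domainWall (trigWeights p q (p - q)⁻¹)
      (z :: List.replicate (2 * n + 1) 1) = ∑ j : Fin (2 * n + 1), (p + q) *
        ((p - q)⁻¹ * (p * z - q)) ^ (j : ℕ) * ((p - q)⁻¹ * (p - q * z)) ^ (2 * n - j) *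
          partialGF (p + q) (singleState j) := by
    change rowSum _ z _ false
      (List.replicate (List.replicate (2 * n + 1) (1 : ℝ)).length false) _ = _
    rw [List.length_replicate, rowSum_false_replicate]
    simp only [hgf p q h, Nat.add_sub_cancel]
    simp only [trigWeights]
    rw [show (p - q)⁻¹ * (p ^ 2 - q ^ 2) = p + q by field_simp; ring]
  have hsymm (t : ℝ) (ht : 0 < t) :
      ∑ j : Fin (2 * n + 1), partialGF (p + q) (singleState j) * t ^ (j : ℕ) =
        ∑ j : Fin (2 * n + 1), partialGF (p + q) (singleState j) * t ^ (2 * n - j) := by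
    have hpt : p + q * t ≠ 0 := by positivity
    have key := domainWall_swap_replicate_one h hp (p - q)⁻¹ n ((p * t + q) / (p + q * t))
    rw [← inv_neg, neg_sub, hDW p q hpq0, hDW q p (by rwa [← neg_sub, neg_ne_zero])] at key
    obtain ⟨b, hb⟩ : ∃ b, b = (p + q) / (p + q * t) := ⟨_, rfl⟩
    have hb0 : b ≠ 0 := by rw [hb]; positivity
    have hqp0 : q - p ≠ 0 := by rwa [← neg_sub, neg_ne_zero]
    have e1 : (p - q)⁻¹ * (p * ((p * t + q) / (p + q * t)) - q) = t * b := by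
      rw [hb]; field_simp; ring
    have e2 : (p - q)⁻¹ * (p - q * ((p * t + q) / (p + q * t))) = b := by
      rw [hb]; field_simp; ring
    have e3 : (q - p)⁻¹ * (q * ((p * t + q) / (p + q * t)) - p) = b := by
      rw [hb]; field_simp; ring
    have e4 : (q - p)⁻¹ * (q - p * ((p * t + q) / (p + q * t))) = t * b := by
      rw [hb]; field_simp; ring
    simp only [e1, e2, e3, e4, add_comm q p] at key
    have hpow (j : Fin (2 * n + 1)) : b ^ (j : ℕ) * b ^ (2 * n - j) = b ^ (2 * n) := by
      rw [← pow_add]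
      congr 1
      omega
    have hc : (p + q) * b ^ (2 * n) ≠ 0 := by positivity
    apply mul_left_cancel₀ hc
    rw [mul_sum, mul_sum]
    convert key using 2 with j _ j _ <;> rw [mul_pow, ← hpow j] <;> ring
  let P : Polynomial ℝ := ∑ j : Fin (2 * n + 1),
    Polynomial.C (partialGF (p + q) (singleState j)) * Polynomial.X ^ (j : ℕ)
  let Q : Polynomial ℝ := ∑ j : Fin (2 * n + 1),
    Polynomial.C (partialGF (p + q) (singleState j.rev)) * Polynomial.X ^ (j : ℕ)
  have hPQ : P = Q := by
    refine Polynomial.eq_of_infinite_eval_eq P Q ((Set.Ioi_infinite (0 : ℝ)).mono fun t ht => ?_)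
    simp only [Set.mem_ofPred_eq, P, Q, Polynomial.eval_finsetSum, Polynomial.eval_mul,
      Polynomial.eval_C, Polynomial.eval_pow, Polynomial.eval_X]
    rw [hsymm t ht, ← Equiv.sum_comp Fin.revPerm]
    refine sum_congr rfl fun i _ => ?_
    rw [Fin.revPerm_apply, Fin.val_rev]
    congr 2
    omega
  have := congrArg (fun R : Polynomial ℝ => R.coeff j) hPQ
  simpa [P, Q, Polynomial.finsetSum_coeff, Polynomial.coeff_C_mul, Polynomial.coeff_X_pow,
    Fin.val_inj] using this.symm

theorem isPartialRow_singleState {m : ℕ} (j : Fin m) :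
    IsPartialRow 0 fun i => stateValue (singleState j i) := by
  refine ⟨fun k => ?_, by simp [stateValue, singleState]⟩
  by_cases h : j ≤ k <;> simp [stateValue, singleState, h, and_comm]

theorem exists_eq_singleState {m : ℕ} {s : Fin m → Bool} (h : ∑ i, stateValue (s i) = 1) :
    ∃ j, s = singleState j := by
  simp only [stateValue, sum_boole] at h
  obtain ⟨j, hj⟩ := card_eq_one.1 (Nat.cast_eq_one.1 h)
  refine ⟨j, funext fun i => ?_⟩
  have := Finset.ext_iff.1 hj i
  simp only [mem_filter_univ, mem_singleton] at this
  simp [singleState, ← this]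

theorem singleState_injective {m : ℕ} : Function.Injective (singleState (m := m)) := by
  intro i j h
  simpa [singleState] using congrFun h i

theorem rowWeight_singleState (y : ℝ) {m : ℕ} (j : Fin m) :
    rowWeight y false (fun _ => false) (singleState j) = y := by
  have h := isPartialRow_singleState j
  simp only [stateValue] at h
  simp only [rowWeight, stateValue, Bool.false_eq_true, if_false, sub_zero, h, if_true]
  simp [singleState, apply_ite]

theorem isOSASMeven_iff_mem {m : ℕ} {A : Matrix (Fin m) (Fin m) ℤ} :
    IsOSASMeven A ↔ A ∈ partialOSASMs fun _ => false := by
  rw [isOSASMeven_iff, mem_partialOSASMs]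
  rfl

theorem IsOSASMeven.exists_statesAfter_eq {m : ℕ} {A : Matrix (Fin (m + 1)) (Fin (m + 1)) ℤ}
    (hA : IsOSASMeven A) :
    ∃ j, statesAfter (fun _ => false) A = singleState j ∧ Tstat A = j + 2 := by
  have hs := stateValue_statesAfter (isOSASMeven_iff_mem.1 hA)
  simp only [stateValue, Bool.false_eq_true, if_false, sub_zero] at hs
  have hsum := hA.1.1.2.2.2.1 0
  rw [Fin.sum_univ_succ, hA.2 0, zero_add] at hsum
  simp only [← hs] at hsum
  obtain ⟨j, hj⟩ := exists_eq_singleState hsum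
  refine ⟨j, hj, ?_⟩
  simp [Tstat, sum_filter, Fintype.sum_prod_type, Fin.sum_univ_succ, hA.2 0, ← hs, hj,
    singleState, apply_ite]

theorem IsOSASMeven.Tstat_eq_iff {m : ℕ} {A : Matrix (Fin (m + 1)) (Fin (m + 1)) ℤ}
    (hA : IsOSASMeven A) (j : Fin m) :
    Tstat A = j + 2 ↔ statesAfter (fun _ => false) A = singleState j := by
  obtain ⟨i, hi, hT⟩ := hA.exists_statesAfter_eq
  rw [hi, hT, singleState_injective.eq_iff, Nat.add_right_cancel_iff, Fin.val_inj]

theorem natCard_isOSASMeven {m : ℕ} (r : ℕ) (j : Fin m) :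
    Nat.card {A : Matrix (Fin (m + 1)) (Fin (m + 1)) ℤ //
        IsOSASMeven A ∧ Rstat A = r ∧ Tstat A = j + 2} =
      (((partialOSASMs fun _ : Fin (m + 1) => false).filter
        fun A => statesAfter (fun _ => false) A = singleState j).filter
          fun A => Rstat A = r).card := by
  refine Nat.subtype_card _ fun A => ?_
  rw [mem_filter, mem_filter, ← isOSASMeven_iff_mem, and_assoc, and_comm (b := Rstat A = r)]
  exact and_congr_right fun hA => and_congr_right fun _ => (hA.Tstat_eq_iff j).symm

/-- Finite sets on which the generating functions of a statistic agree infinitely often have the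
same number of elements with each value of the statistic. -/
theorem card_filter_eq_of_infinite {α : Type*} (f : α → ℕ) (s t : Finset α)
    (h : {y : ℝ | ∑ a ∈ s, y ^ f a = ∑ a ∈ t, y ^ f a}.Infinite) (r : ℕ) :
    (s.filter fun a => f a = r).card = (t.filter fun a => f a = r).card := by
  have hP : ∑ a ∈ s, (Polynomial.X : Polynomial ℝ) ^ f a = ∑ a ∈ t, Polynomial.X ^ f a := by
    refine Polynomial.eq_of_infinite_eval_eq _ _ ?_
    simpa [Polynomial.eval_finsetSum] using h
  have := congrArg (fun R : Polynomial ℝ => R.coeff r) hP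
  simpa [Polynomial.finsetSum_coeff, Polynomial.coeff_X_pow, eq_comm] using this

theorem infinite_setOf_add_inv : {y : ℝ | ∃ p, 1 < p ∧ y = p + p⁻¹}.Infinite := by
  have hinj : Set.InjOn (fun p : ℝ => p + p⁻¹) (Set.Ioi 1) := by
    intro a ha b hb hab
    simp only [Set.mem_Ioi] at ha hb hab
    have ha0 : a ≠ 0 := by positivity
    have hb0 : b ≠ 0 := by positivity
    field_simp at hab
    have h : (a - b) * (a * b - 1) = 0 := by linear_combination hab
    have hab1 : a * b - 1 ≠ 0 := by nlinarith
    exact sub_eq_zero.1 ((mul_eq_zero.1 h).resolve_right hab1)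
  refine ((Set.infinite_image_iff hinj).2 (Set.Ioi_infinite 1)).mono ?_
  rintro _ ⟨p, hp, rfl⟩
  exact ⟨p, hp, rfl⟩

theorem natCard_isOSASMeven_rev (n r : ℕ) (j : Fin (2 * n + 1)) :
    Nat.card {A : Matrix (Fin (2 * n + 2)) (Fin (2 * n + 2)) ℤ //
        IsOSASMeven A ∧ Rstat A = r ∧ Tstat A = j.rev + 2} =
      Nat.card {A : Matrix (Fin (2 * n + 2)) (Fin (2 * n + 2)) ℤ //
        IsOSASMeven A ∧ Rstat A = r ∧ Tstat A = j + 2} := by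
  rw [natCard_isOSASMeven, natCard_isOSASMeven]
  refine card_filter_eq_of_infinite _ _ _ (infinite_setOf_add_inv.mono ?_) r
  rintro _ ⟨p, hp, rfl⟩
  simp only [Set.mem_ofPred_eq, sum_statesAfter_eq, rowWeight_singleState,
    partialGF_singleState_rev hp]

theorem natCard_isOSASMeven_reflect (n r t : ℕ) :
    Nat.card {A : Matrix (Fin (2 * n + 2)) (Fin (2 * n + 2)) ℤ //
        IsOSASMeven A ∧ Rstat A = r ∧ Tstat A = t} =
      Nat.card {A : Matrix (Fin (2 * n + 2)) (Fin (2 * n + 2)) ℤ //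
        IsOSASMeven A ∧ Rstat A = r ∧ Tstat A = 2 * n + 2 + 2 - t} := by
  by_cases ht : 2 ≤ t ∧ t < 2 * n + 3
  · obtain ⟨j, rfl⟩ : ∃ j : Fin (2 * n + 1), t = j + 2 := ⟨⟨t - 2, by omega⟩, by simp; omega⟩
    rw [← natCard_isOSASMeven_rev, Fin.val_rev]
    congr! 6
    omega
  · have hempty (u : ℕ) (hu : ¬(2 ≤ u ∧ u < 2 * n + 3)) :
        IsEmpty {A : Matrix (Fin (2 * n + 2)) (Fin (2 * n + 2)) ℤ //
          IsOSASMeven A ∧ Rstat A = r ∧ Tstat A = u} := by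
      refine ⟨fun ⟨A, hA, _, hT⟩ => hu ?_⟩
      obtain ⟨j, _, hj⟩ := hA.exists_statesAfter_eq
      omega
    have := hempty t ht
    have := hempty (2 * n + 2 + 2 - t) (by omega)
    rw [Nat.card_of_isEmpty, Nat.card_of_isEmpty]

/-- The number of A ∈ OSASM(2n) with R(A) = r₀ and T(A) = t₀ equals the number of
A ∈ OSASM(2n) with R(A) = r₀ and T(A) = 2n+2−t₀. -/
theorem osasm_even_refined_symmetry (n : ℕ) (hn : 1 ≤ n) (r₀ t₀ : ℕ) :
    Nat.card {A : Matrix (Fin (2*n)) (Fin (2*n)) ℤ //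
        IsOSASMeven A ∧ Rstat A = r₀ ∧ Tstat A = t₀} =
      Nat.card {A : Matrix (Fin (2*n)) (Fin (2*n)) ℤ //
        IsOSASMeven A ∧ Rstat A = r₀ ∧ Tstat A = 2*n+2 - t₀} := by
  obtain ⟨n, rfl⟩ := Nat.exists_eq_add_of_le' hn
  exact natCard_isOSASMeven_reflect n r₀ t₀
end

section
/- The OSASM generating function refined by the first-row statistic and evaluated at t = -1 satisfies X^O_{2n}(1,-1) = ((3n-1)!/(2^n (2n-1)!)) · ∏_{i=1}^{n-1} (6i-2)!/(2n+2i-1)!, where X^O_{2n}(1,t) = ∑_{A ∈ OSASM(2n)} t^{T(A)}. -/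
open Finset

/-- Six-vertex weight for spectral parameter `P` at a cube root of unity `w`, normalised to be `1`
at `P = 1`; the states `h v` enter the vertex and `h' v'` leave it. -/
noncomputable def vertexWeight (w P : ℂ) : Bool → Bool → Bool → Bool → ℂ
  | false, false, false, false => (w ^ 2 - 1) / 3 * (w * P - 1)
  | true, true, true, true => (w ^ 2 - 1) / 3 * (w * P - 1)
  | false, true, false, true => (w ^ 2 - 1) / 3 * (w - P)
  | true, false, true, false => (w ^ 2 - 1) / 3 * (w - P)
  | false, false, true, true => 1
  | true, true, false, false => P
  | _, _, _, _ => 0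

/-- Transfer functional of a horizontal line with parameter `x` entering in state `h` and leaving
in state `true`, crossing vertical lines with parameters `ys` and incoming states `vs`. -/
noncomputable def rowTransfer (w x : ℂ) : Bool → List ℂ → List Bool → (List Bool → ℂ) → ℂ
  | h, [], [], k => if h then k [] else 0
  | h, y :: ys, v :: vs, k => ∑ h' : Bool, ∑ v' : Bool,
      vertexWeight w (x * y) h v h' v' * rowTransfer w x h' ys vs (fun l => k (v' :: l))
  | _, _, _, _ => 0

/-- Partition function of the triangular six-vertex model with parameters `xs` and incoming
vertical states. -/
noncomputable def partitionFn (w : ℂ) : List ℂ → List Bool → ℂ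
  | [], [] => 1
  | x :: xs, v :: vs => rowTransfer w x v xs vs (partitionFn w xs)
  | _, _ => 0

/-- The R-matrix exchanging two adjacent lines with parameters `x` and `y`. -/
noncomputable def exchangeWeight (w x y : ℂ) : Bool → Bool → Bool → Bool → ℂ
  | false, false, false, false => x - w ^ 2 * y
  | true, true, true, true => x - w ^ 2 * y
  | true, false, true, false => (1 - w ^ 2) * y
  | false, true, false, true => (1 - w ^ 2) * x
  | true, false, false, true => -w * (x - y)
  | false, true, true, false => -w * (x - y)
  | _, _, _, _ => 0

/-- The R-matrix acting on positions `i`, `i + 1` of a function of states. -/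
noncomputable def exchangeOp (w x y : ℂ) : ℕ → (List Bool → ℂ) → List Bool → ℂ
  | 0, f, v₁ :: v₂ :: vs =>
      ∑ u₁ : Bool, ∑ u₂ : Bool, exchangeWeight w x y v₁ v₂ u₁ u₂ * f (u₁ :: u₂ :: vs)
  | i + 1, f, v :: vs => exchangeOp w x y i (fun l => f (v :: l)) vs
  | _, _, _ => 0

section Exchange

variable {w : ℂ}

lemma rowTransfer_add (x : ℂ) (h : Bool) (ys : List ℂ) (vs : List Bool) (k k' : List Bool → ℂ) :
    rowTransfer w x h ys vs (fun l => k l + k' l) =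
      rowTransfer w x h ys vs k + rowTransfer w x h ys vs k' := by
  induction ys generalizing h vs k k' with
  | nil => cases vs <;> cases h <;> simp [rowTransfer]
  | cons y ys ih =>
    cases vs with
    | nil => simp [rowTransfer]
    | cons v vs => simp only [rowTransfer, ih, Fintype.sum_bool]; ring

lemma rowTransfer_mul (x : ℂ) (h : Bool) (ys : List ℂ) (vs : List Bool) (k : List Bool → ℂ)
    (c : ℂ) :
    rowTransfer w x h ys vs (fun l => c * k l) = c * rowTransfer w x h ys vs k := by
  induction ys generalizing h vs k with
  | nil => cases vs <;> cases h <;> simp [rowTransfer]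
  | cons y ys ih =>
    cases vs with
    | nil => simp [rowTransfer]
    | cons v vs => simp only [rowTransfer, ih, Fintype.sum_bool]; ring

lemma rowTransfer_congr (x : ℂ) (h : Bool) (ys : List ℂ) (vs : List Bool) {k k' : List Bool → ℂ}
    (hk : ∀ l, l.length = ys.length → k l = k' l) :
    rowTransfer w x h ys vs k = rowTransfer w x h ys vs k' := by
  induction ys generalizing h vs k k' with
  | nil => cases vs <;> cases h <;> simp [rowTransfer, hk]
  | cons y ys ih =>
    cases vs with
    | nil => simp [rowTransfer]
    | cons v vs =>
      simp only [rowTransfer]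
      refine Finset.sum_congr rfl fun h' _ => Finset.sum_congr rfl fun v' _ => ?_
      rw [ih h' vs fun l hl => hk (v' :: l) (by simp [hl])]

lemma exchangeOp_add (x y : ℂ) (i : ℕ) (f g : List Bool → ℂ) (vs : List Bool) :
    exchangeOp w x y i (fun l => f l + g l) vs =
      exchangeOp w x y i f vs + exchangeOp w x y i g vs := by
  induction i generalizing f g vs with
  | zero =>
    match vs with
    | [] => simp [exchangeOp]
    | [_] => simp [exchangeOp]
    | v₁ :: v₂ :: vs => simp only [exchangeOp, Fintype.sum_bool]; ring
  | succ i ih =>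
    match vs with
    | [] => simp [exchangeOp]
    | v :: vs => simp only [exchangeOp, ih]

lemma exchangeOp_mul (x y : ℂ) (i : ℕ) (f : List Bool → ℂ) (c : ℂ) (vs : List Bool) :
    exchangeOp w x y i (fun l => c * f l) vs = c * exchangeOp w x y i f vs := by
  induction i generalizing f vs with
  | zero =>
    match vs with
    | [] => simp [exchangeOp]
    | [_] => simp [exchangeOp]
    | v₁ :: v₂ :: vs => simp only [exchangeOp, Fintype.sum_bool]; ring
  | succ i ih =>
    match vs with
    | [] => simp [exchangeOp]
    | v :: vs => simp only [exchangeOp, ih]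

lemma exchangeOp_replicate_false (x y : ℂ) (i m : ℕ) (f : List Bool → ℂ) (hm : i + 2 ≤ m) :
    exchangeOp w x y i f (List.replicate m false) =
      (x - w ^ 2 * y) * f (List.replicate m false) := by
  induction i generalizing f m with
  | zero =>
    obtain ⟨m, rfl⟩ := Nat.exists_eq_add_of_le' hm
    simp [exchangeOp, exchangeWeight, List.replicate_succ]
  | succ i ih =>
    obtain ⟨m, rfl⟩ := Nat.exists_eq_add_of_le' (show 1 ≤ m by omega)
    simp only [exchangeOp, List.replicate_succ]
    rw [ih _ _ (by omega)]

/-- Two-vertex Yang–Baxter equation. -/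
lemma yang_baxter_s11 (hw : w ^ 2 + w + 1 = 0) (x y z : ℂ) (h v₁ v₂ h'' v₁' v₂' : Bool) :
    ∑ u₁ : Bool, ∑ u₂ : Bool, exchangeWeight w y z v₁ v₂ u₁ u₂ *
      ∑ h' : Bool, vertexWeight w (x * y) h u₁ h' v₁' * vertexWeight w (x * z) h' u₂ h'' v₂' =
    ∑ u₁ : Bool, ∑ u₂ : Bool, (∑ h' : Bool, vertexWeight w (x * z) h v₁ h' u₁ *
      vertexWeight w (x * y) h' v₂ h'' u₂) * exchangeWeight w y z u₁ u₂ v₁' v₂' := by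
  cases h <;> cases v₁ <;> cases v₂ <;> cases h'' <;> cases v₁' <;> cases v₂' <;>
    simp only [Fintype.sum_bool, vertexWeight, exchangeWeight] <;> first | ring1 | grind

end Exchange

section Symmetry

variable {w : ℂ}

lemma exchangeOp_zero_rowTransfer (hw : w ^ 2 + w + 1 = 0) (x y z : ℂ) (h : Bool) (ys : List ℂ)
    (vs : List Bool) (k : List Bool → ℂ) :
    exchangeOp w y z 0 (fun l => rowTransfer w x h (y :: z :: ys) l k) vs =
      rowTransfer w x h (z :: y :: ys) vs (exchangeOp w y z 0 k) := by
  match vs with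
  | [] => simp [exchangeOp, rowTransfer]
  | [_] => simp [exchangeOp, rowTransfer]
  | v₁ :: v₂ :: vs =>
    have key := fun h'' v₁' v₂' => yang_baxter_s11 hw x y z h v₁ v₂ h'' v₁' v₂'
    simp only [exchangeOp, rowTransfer, rowTransfer_add, rowTransfer_mul, Fintype.sum_bool]
      at key ⊢
    linear_combination
      key true true true * rowTransfer w x true ys vs (fun l => k (true :: true :: l)) +
      key true true false * rowTransfer w x true ys vs (fun l => k (true :: false :: l)) +
      key true false true * rowTransfer w x true ys vs (fun l => k (false :: true :: l)) +
      key true false false * rowTransfer w x true ys vs (fun l => k (false :: false :: l)) +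
      key false true true * rowTransfer w x false ys vs (fun l => k (true :: true :: l)) +
      key false true false * rowTransfer w x false ys vs (fun l => k (true :: false :: l)) +
      key false false true * rowTransfer w x false ys vs (fun l => k (false :: true :: l)) +
      key false false false * rowTransfer w x false ys vs (fun l => k (false :: false :: l))

lemma exchangeOp_rowTransfer (hw : w ^ 2 + w + 1 = 0) (x y z : ℂ) (h : Bool) (pre ys : List ℂ)
    (vs : List Bool) (k : List Bool → ℂ) :
    exchangeOp w y z pre.length (fun l => rowTransfer w x h (pre ++ y :: z :: ys) l k) vs =
      rowTransfer w x h (pre ++ z :: y :: ys) vs (exchangeOp w y z pre.length k) := by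
  induction pre generalizing h vs k with
  | nil => exact exchangeOp_zero_rowTransfer hw x y z h ys vs k
  | cons p pre ih =>
    match vs with
    | [] => simp [exchangeOp, rowTransfer]
    | v :: vs =>
      simp only [List.length_cons, List.cons_append, exchangeOp, rowTransfer, Fintype.sum_bool,
        exchangeOp_add, exchangeOp_mul, ih]

lemma vertexWeight_swap (P : ℂ) (h v h' v' : Bool) :
    vertexWeight w P h v h' v' = vertexWeight w P v h v' h' := by
  cases h <;> cases v <;> cases h' <;> cases v' <;> rfl

lemma yang_baxter_vertical (hw : w ^ 2 + w + 1 = 0) (x y z : ℂ)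
    (v h₁ h₂ v'' h₁' h₂' : Bool) :
    ∑ g₁ : Bool, ∑ g₂ : Bool, exchangeWeight w x y h₁ h₂ g₁ g₂ *
      ∑ v' : Bool, vertexWeight w (x * z) g₁ v h₁' v' * vertexWeight w (y * z) g₂ v' h₂' v'' =
    ∑ g₁ : Bool, ∑ g₂ : Bool, (∑ v' : Bool, vertexWeight w (y * z) h₁ v g₁ v' *
      vertexWeight w (x * z) h₂ v' g₂ v'') * exchangeWeight w x y g₁ g₂ h₁' h₂' := by
  have key := yang_baxter_s11 hw z x y v h₁ h₂ v'' h₁' h₂'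
  simp only [mul_comm z] at key
  refine Eq.trans ?_ (key.trans ?_) <;>
  · refine Finset.sum_congr rfl fun g₁ _ => Finset.sum_congr rfl fun g₂ _ => ?_
    congr 1
    refine Finset.sum_congr rfl fun v' _ => ?_
    rw [vertexWeight_swap (x * z), vertexWeight_swap (y * z)]

/-- The R-matrix passes through a pair of rows and is absorbed by the boundary. -/
lemma exchange_two_rows_s11 (hw : w ^ 2 + w + 1 = 0) (x y : ℂ) (h₁ h₂ : Bool) (ys : List ℂ)
    (vs : List Bool) (k : List Bool → ℂ) :
    ∑ g₁ : Bool, ∑ g₂ : Bool, exchangeWeight w x y h₁ h₂ g₁ g₂ *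
        rowTransfer w x g₁ ys vs (fun l => rowTransfer w y g₂ ys l k) =
      (x - w ^ 2 * y) * rowTransfer w y h₁ ys vs (fun l => rowTransfer w x h₂ ys l k) := by
  induction ys generalizing h₁ h₂ vs k with
  | nil =>
    match vs with
    | [] => cases h₁ <;> cases h₂ <;> simp [rowTransfer, exchangeWeight]
    | _ :: _ => simp [rowTransfer]
  | cons z ys ih =>
    match vs with
    | [] => simp [rowTransfer]
    | v :: vs =>
      have key := fun v'' g₁ g₂ => yang_baxter_vertical hw x y z v h₁ h₂ v'' g₁ g₂
      have ih' := fun v'' g₁ g₂ => ih g₁ g₂ vs (fun l => k (v'' :: l))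
      simp only [rowTransfer, rowTransfer_add, rowTransfer_mul, Fintype.sum_bool] at key ih' ⊢
      have expand : ∀ f g : Bool → Bool → Bool → ℂ, (∀ a b c, f a b c = g a b c) →
          ∑ a : Bool, ∑ b : Bool, ∑ c : Bool, f a b c =
            ∑ a : Bool, ∑ b : Bool, ∑ c : Bool, g a b c := fun f g hfg =>
        Finset.sum_congr rfl fun a _ => Finset.sum_congr rfl fun b _ =>
          Finset.sum_congr rfl fun c _ => hfg a b c
      have e₁ := expand _ _ fun v'' g₁ g₂ => congrArg (· * rowTransfer w x g₁ ys vs (fun l =>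
        rowTransfer w y g₂ ys l (fun l => k (v'' :: l)))) (key v'' g₁ g₂)
      have e₂ := expand _ _ fun v'' g₁ g₂ => congrArg ((vertexWeight w (y * z) h₁ v g₁ true *
        vertexWeight w (x * z) h₂ true g₂ v'' + vertexWeight w (y * z) h₁ v g₁ false *
        vertexWeight w (x * z) h₂ false g₂ v'') * ·) (ih' v'' g₁ g₂)
      simp only [Fintype.sum_bool] at e₁ e₂
      linear_combination e₁ + e₂

lemma exchangeOp_partitionFn (hw : w ^ 2 + w + 1 = 0) (x y : ℂ) (pre xs : List ℂ)
    (vs : List Bool) :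
    exchangeOp w x y pre.length (partitionFn w (pre ++ x :: y :: xs)) vs =
      (x - w ^ 2 * y) * partitionFn w (pre ++ y :: x :: xs) vs := by
  induction pre generalizing vs with
  | nil =>
    match vs with
    | [] => simp [exchangeOp, partitionFn]
    | [_] => simp [exchangeOp, partitionFn, rowTransfer]
    | v₁ :: v₂ :: vs =>
      have key := fun h₁ h₂ => exchange_two_rows_s11 hw x y h₁ h₂ xs vs (partitionFn w xs)
      simp only [List.length_nil, List.nil_append, exchangeOp, partitionFn, rowTransfer,
        Fintype.sum_bool, mul_comm y x] at key ⊢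
      cases v₁ <;> cases v₂ <;> simp only [vertexWeight, exchangeWeight] at key ⊢
      · linear_combination (w ^ 2 - 1) / 3 * (w * (x * y) - 1) * key false false + key true true
      · linear_combination (w ^ 2 - 1) / 3 * (w - x * y) * key false true
      · linear_combination (w ^ 2 - 1) / 3 * (w - x * y) * key true false
      · linear_combination (w ^ 2 - 1) / 3 * (w * (x * y) - 1) * key true true +
          x * y * key false false
  | cons p pre ih =>
    match vs with
    | [] => simp [exchangeOp, partitionFn]
    | v :: vs =>
      simp only [List.length_cons, List.cons_append, exchangeOp, partitionFn,
        exchangeOp_rowTransfer hw]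
      rw [← rowTransfer_mul]
      exact rowTransfer_congr _ _ _ _ fun l _ => ih l

/-- With no incoming arrows the partition function is symmetric in its parameters. -/
lemma partitionFn_swap (hw : w ^ 2 + w + 1 = 0) (x y : ℂ) (hxy : x - w ^ 2 * y ≠ 0)
    (pre xs : List ℂ) {m : ℕ} (hm : m = (pre ++ x :: y :: xs).length) :
    partitionFn w (pre ++ x :: y :: xs) (List.replicate m false) =
      partitionFn w (pre ++ y :: x :: xs) (List.replicate m false) := by
  have key := exchangeOp_partitionFn hw x y pre xs (List.replicate m false)
  rw [exchangeOp_replicate_false _ _ _ _ _ (by simp [hm])] at key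
  exact mul_left_cancel₀ hxy key

lemma partitionFn_perm (hw : w ^ 2 + w + 1 = 0) {l l' : List ℂ} (hl : l.Perm l')
    (hgen : ∀ x ∈ l, ∀ y ∈ l, x - w ^ 2 * y ≠ 0) (pre : List ℂ) {m : ℕ}
    (hm : m = (pre ++ l).length) :
    partitionFn w (pre ++ l) (List.replicate m false) =
      partitionFn w (pre ++ l') (List.replicate m false) := by
  induction hl generalizing pre with
  | nil => rfl
  | cons x _ ih =>
    have := ih (fun a ha b hb => hgen a (by simp [ha]) b (by simp [hb])) (pre ++ [x])
      (by simpa using hm)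
    simpa using this
  | swap x y l => exact partitionFn_swap hw _ _ (hgen _ (by simp) _ (by simp)) _ _ hm
  | trans h₁ _ ih₁ ih₂ =>
    rw [ih₁ hgen pre hm]
    refine ih₂ (fun a ha b hb => hgen a (h₁.mem_iff.2 ha) b (h₁.mem_iff.2 hb)) pre ?_
    rw [hm, List.length_append, List.length_append, h₁.length_eq]

end Symmetry

section Freezing

variable {w : ℂ}

lemma rowTransfer_true_replicate (x : ℂ) (ys : List ℂ) (k : List Bool → ℂ) :
    rowTransfer w x true ys (List.replicate ys.length false) k =
      (ys.map fun y => (w ^ 2 - 1) / 3 * (w - x * y)).prod *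
        k (List.replicate ys.length false) := by
  induction ys generalizing k with
  | nil => simp [rowTransfer]
  | cons y ys ih =>
    simp [rowTransfer, List.replicate_succ, vertexWeight, ih, mul_assoc]

lemma rowTransfer_false_cons_replicate (x y : ℂ) (ys : List ℂ) (k : List Bool → ℂ) :
    rowTransfer w x false (y :: ys) (List.replicate (ys.length + 1) false) k =
      (ys.map fun y => (w ^ 2 - 1) / 3 * (w - x * y)).prod *
        k (true :: List.replicate ys.length false) +
      (w ^ 2 - 1) / 3 * (w * (x * y) - 1) *
        rowTransfer w x false ys (List.replicate ys.length false) (fun l => k (false :: l)) := by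
  simp [rowTransfer, List.replicate_succ, vertexWeight, rowTransfer_true_replicate]

lemma partitionFn_of_mul_eq_inv (x y : ℂ) (hxy : w * (x * y) = 1) (ys : List ℂ) :
    partitionFn w (x :: y :: ys) (List.replicate (ys.length + 2) false) =
      (ys.map fun z => (w ^ 2 - 1) / 3 * (w - x * z)).prod *
      (ys.map fun z => (w ^ 2 - 1) / 3 * (w - y * z)).prod *
        partitionFn w ys (List.replicate ys.length false) := by
  rw [List.replicate_succ, partitionFn, rowTransfer_false_cons_replicate, hxy, partitionFn,
    rowTransfer_true_replicate]
  ring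

lemma rowTransfer_append_true (x z : ℂ) (h : Bool) (ys : List ℂ) (vs : List Bool)
    (hvs : vs.length = ys.length) (k : List Bool → ℂ) :
    rowTransfer w x h (ys ++ [z]) (vs ++ [true]) k =
      (w ^ 2 - 1) / 3 * (w * (x * z) - 1) *
        rowTransfer w x h ys vs (fun l => k (l ++ [true])) := by
  induction ys generalizing h vs k with
  | nil =>
    obtain rfl : vs = [] := by simpa using hvs
    cases h <;> simp [rowTransfer, vertexWeight]
  | cons y ys ih =>
    match vs with
    | v :: vs =>
      have hvs' : vs.length = ys.length := by simpa using hvs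
      simp only [List.cons_append, rowTransfer, ih _ vs hvs', Fintype.sum_bool]
      ring

lemma partitionFn_append_true (z : ℂ) (ys : List ℂ) (vs : List Bool)
    (hvs : vs.length = ys.length) :
    partitionFn w (ys ++ [z]) (vs ++ [true]) =
      (ys.map fun y => (w ^ 2 - 1) / 3 * (w * (y * z) - 1)).prod * partitionFn w ys vs := by
  induction ys generalizing vs with
  | nil =>
    obtain rfl : vs = [] := by simpa using hvs
    simp [partitionFn, rowTransfer]
  | cons y ys ih =>
    match vs with
    | v :: vs =>
      have hvs' : vs.length = ys.length := by simpa using hvs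
      simp only [List.cons_append, partitionFn, rowTransfer_append_true _ _ _ _ _ hvs',
        List.map_cons, List.prod_cons]
      rw [rowTransfer_congr _ _ _ _ fun l hl => ih l hl, rowTransfer_mul]
      ring

lemma rowTransfer_false_append_replicate (x z : ℂ) (hxz : x * z = w) (ys : List ℂ)
    (k : List Bool → ℂ) :
    rowTransfer w x false (ys ++ [z]) (List.replicate (ys.length + 1) false) k =
      (ys.map fun y => (w ^ 2 - 1) / 3 * (w * (x * y) - 1)).prod *
        k (List.replicate ys.length false ++ [true]) := by
  induction ys generalizing k with
  | nil => simp [rowTransfer, vertexWeight]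
  | cons y ys ih =>
    have h := rowTransfer_false_cons_replicate (w := w) x y (ys ++ [z]) k
    simp only [List.length_append, List.length_singleton] at h
    rw [List.cons_append, List.length_cons, h, ih]
    simp [hxz, List.replicate_succ, mul_assoc]

lemma partitionFn_of_mul_eq (x z : ℂ) (hxz : x * z = w) (ys : List ℂ) :
    partitionFn w (x :: (ys ++ [z])) (List.replicate (ys.length + 2) false) =
      (ys.map fun y => (w ^ 2 - 1) / 3 * (w * (x * y) - 1)).prod *
      (ys.map fun y => (w ^ 2 - 1) / 3 * (w * (y * z) - 1)).prod *
        partitionFn w ys (List.replicate ys.length false) := by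
  rw [List.replicate_succ, partitionFn, rowTransfer_false_append_replicate x z hxz,
    partitionFn_append_true _ _ _ (by simp)]
  ring

end Freezing

section SumRule

open Polynomial

variable {w : ℂ}

lemma exists_polynomial_prod (ys : List ℂ) :
    ∃ p : ℂ[X], p.natDegree ≤ ys.length ∧
      ∀ x, (ys.map fun y => (w ^ 2 - 1) / 3 * (w - x * y)).prod = p.eval x := by
  induction ys with
  | nil => exact ⟨1, by simp, by simp⟩
  | cons y ys ih =>
    obtain ⟨p, hp, h⟩ := ih
    refine ⟨C ((w ^ 2 - 1) / 3) * (C w - X * C y) * p, ?_, fun x => by simp [h, mul_comm x y]⟩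
    refine natDegree_mul_le.trans ?_
    have : (C ((w ^ 2 - 1) / 3) * (C w - X * C y)).natDegree ≤ 1 := by compute_degree
    simp only [List.length_cons]
    omega

lemma exists_polynomial_rowTransfer (ys : List ℂ) (k : List Bool → ℂ) :
    ∃ p : ℂ[X], p.degree < ys.length ∧
      ∀ x, rowTransfer w x false ys (List.replicate ys.length false) k = p.eval x := by
  induction ys generalizing k with
  | nil => exact ⟨0, by simp, by simp [rowTransfer]⟩
  | cons y ys ih =>
    obtain ⟨p, hp, h⟩ := ih (fun l => k (false :: l))
    obtain ⟨q, hq, h'⟩ := exists_polynomial_prod (w := w) ys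
    refine ⟨q * C (k (true :: List.replicate ys.length false)) +
      C ((w ^ 2 - 1) / 3) * (C w * (X * C y) - 1) * p, ?_, fun x => ?_⟩
    · have h₁ : (q * C (k (true :: List.replicate ys.length false))).degree ≤ ys.length :=
        degree_le_of_natDegree_le (natDegree_mul_le.trans (by simpa using hq))
      have h₂ : (C ((w ^ 2 - 1) / 3) * (C w * (X * C y) - 1)).degree ≤ 1 := by compute_degree
      refine (degree_add_le _ _).trans_lt (max_lt (h₁.trans_lt ?_) ?_)
      · simp only [List.length_cons]; exact_mod_cast Nat.lt_succ_self _
      · by_cases hp0 : p = 0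
        · simp only [hp0, mul_zero, degree_zero]; exact WithBot.bot_lt_coe _
        · refine (degree_mul_le _ _).trans_lt ?_
          rw [degree_eq_natDegree hp0] at hp ⊢
          have : p.natDegree < ys.length := by exact_mod_cast hp
          refine (add_le_add_left h₂ _).trans_lt ?_
          simp only [List.length_cons]
          exact_mod_cast (by omega : 1 + p.natDegree < ys.length + 1)
    · rw [List.length_cons, rowTransfer_false_cons_replicate, h, h']
      simp [mul_comm x y]

/-- The polynomial in `x` whose expansion omits the exponents congruent to `2` modulo `3`. -/
noncomputable def wheelFn (w : ℂ) (ys : List ℂ) (x : ℂ) : ℂ :=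
  partitionFn w (x :: ys) (List.replicate (ys.length + 1) false) *
    ((x ^ 2 - 1) * (ys.map fun y => (x - y) * (x - y⁻¹)).prod)

lemma exists_polynomial_wheelFn (ys : List ℂ) :
    ∃ H : ℂ[X], H.degree < 3 * ys.length + 2 ∧ ∀ x, wheelFn w ys x = H.eval x := by
  obtain ⟨p, hp, h⟩ := exists_polynomial_rowTransfer (w := w) ys (partitionFn w ys)
  have hprod : ∃ q : ℂ[X], q.natDegree ≤ 2 * ys.length ∧
      ∀ x, (ys.map fun y => (x - y) * (x - y⁻¹)).prod = q.eval x := by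
    clear h hp p
    induction ys with
    | nil => exact ⟨1, by simp, by simp⟩
    | cons y ys ih =>
      obtain ⟨q, hq, h⟩ := ih
      refine ⟨(X - C y) * (X - C y⁻¹) * q, ?_, fun x => by simp [h]⟩
      refine natDegree_mul_le.trans ?_
      have : ((X - C y) * (X - C y⁻¹)).natDegree ≤ 2 := by compute_degree
      simp only [List.length_cons]
      omega
  obtain ⟨q, hq, hq'⟩ := hprod
  refine ⟨p * ((X ^ 2 - 1) * q), ?_, fun x => ?_⟩
  · by_cases hp0 : p = 0
    · simp only [hp0, zero_mul, degree_zero]; exact WithBot.bot_lt_coe (3 * ys.length + 2)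
    · have h₂ : (((X : ℂ[X]) ^ 2 - 1) * q).natDegree ≤ 2 + 2 * ys.length :=
        natDegree_mul_le.trans (add_le_add (by compute_degree) hq)
      have h₃ : p.natDegree < ys.length := by
        rw [degree_eq_natDegree hp0] at hp; exact_mod_cast hp
      refine degree_le_natDegree.trans_lt ?_
      have := natDegree_mul_le (p := p) (q := (X ^ 2 - 1) * q)
      exact_mod_cast (by omega : (p * ((X ^ 2 - 1) * q)).natDegree < 3 * ys.length + 2)
  · rw [wheelFn, List.replicate_succ, partitionFn, h, hq']
    simp

lemma wheelFn_perm (hw : w ^ 2 + w + 1 = 0) {l l' : List ℂ} (hl : l.Perm l')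
    (hgen : ∀ x ∈ l, ∀ y ∈ l, x - w ^ 2 * y ≠ 0) (x : ℂ) : wheelFn w l x = wheelFn w l' x := by
  have := partitionFn_perm hw hl hgen [x] (m := l.length + 1) (by simp)
  simp only [List.singleton_append] at this
  rw [wheelFn, wheelFn, this, hl.length_eq, (hl.map _).prod_eq]

lemma wheelFn_wheel (hw : w ^ 2 + w + 1 = 0) (ys : List ℂ) (hne : ∀ y ∈ ys, y ≠ 0)
    (hgen : ∀ x ∈ ys, ∀ y ∈ ys, x - w ^ 2 * y ≠ 0) {y : ℂ} (hy : y ∈ ys) :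
    wheelFn w ys y⁻¹ + w * wheelFn w ys (w * y⁻¹) + w ^ 2 * wheelFn w ys (w ^ 2 * y⁻¹) = 0 := by
  have hw3 : w ^ 3 = 1 := by linear_combination (w - 1) * hw
  have hy0 := hne y hy
  obtain ⟨l, hl⟩ : ∃ l, ys.Perm (y :: l) := ⟨_, List.perm_cons_erase hy⟩
  have hl' : ys.Perm (l ++ [y]) := hl.trans (List.perm_append_singleton y l).symm
  have h₁ : wheelFn w ys y⁻¹ = 0 := by
    rw [wheelFn_perm hw hl hgen]
    simp [wheelFn]
  have h₂ := partitionFn_of_mul_eq (w := w) (w * y⁻¹) y (by field_simp) l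
  have h₃ := partitionFn_of_mul_eq_inv (w := w) (w ^ 2 * y⁻¹) y
    (by field_simp; linear_combination hw3) l
  have h₄ : (l.map fun z => (w ^ 2 - 1) / 3 * (w * (w * y⁻¹ * z) - 1)).prod *
      (l.map fun z => (w ^ 2 - 1) / 3 * (w * (z * y) - 1)).prod *
      (l.map fun z => (w * y⁻¹ - z) * (w * y⁻¹ - z⁻¹)).prod =
      (l.map fun z => (w ^ 2 - 1) / 3 * (w - w ^ 2 * y⁻¹ * z)).prod *
      (l.map fun z => (w ^ 2 - 1) / 3 * (w - y * z)).prod *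
      (l.map fun z => (w ^ 2 * y⁻¹ - z) * (w ^ 2 * y⁻¹ - z⁻¹)).prod := by
    simp only [← List.prod_map_mul]
    congr 1
    refine List.map_congr_left fun z hz => ?_
    have hz0 : z ≠ 0 := hne z (hl.mem_iff.2 (by simp [hz]))
    field_simp
    grind
  rw [h₁, wheelFn_perm hw hl' hgen (w * y⁻¹), wheelFn_perm hw hl hgen (w ^ 2 * y⁻¹)]
  simp only [wheelFn, List.length_append, List.length_cons, List.length_nil, zero_add,
    List.map_append, List.prod_append, List.map_cons, List.map_nil, List.prod_cons,
    List.prod_nil, mul_one, h₂, h₃]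
  have h₅ : w * ((w * y⁻¹) ^ 2 - 1) * ((w * y⁻¹ - y) * (w * y⁻¹ - y⁻¹)) +
      w ^ 2 * ((w ^ 2 * y⁻¹) ^ 2 - 1) * ((w ^ 2 * y⁻¹ - y) * (w ^ 2 * y⁻¹ - y⁻¹)) = 0 := by
    field_simp
    grind
  linear_combination w * ((w * y⁻¹) ^ 2 - 1) * ((w * y⁻¹ - y) * (w * y⁻¹ - y⁻¹)) *
    partitionFn w l (List.replicate l.length false) * h₄ +
    (l.map fun z => (w ^ 2 - 1) / 3 * (w - w ^ 2 * y⁻¹ * z)).prod *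
      (l.map fun z => (w ^ 2 - 1) / 3 * (w - y * z)).prod *
      (l.map fun z => (w ^ 2 * y⁻¹ - z) * (w ^ 2 * y⁻¹ - z⁻¹)).prod *
      partitionFn w l (List.replicate l.length false) * h₅

end SumRule

section Homogeneous

open Polynomial

variable {w : ℂ}

lemma sum_range_three_mul {R : Type*} [AddCommMonoid R] (f : ℕ → R) (m : ℕ) :
    ∑ e ∈ range (3 * m), f e = ∑ i ∈ range m, (f (3 * i) + f (3 * i + 1) + f (3 * i + 2)) := by
  induction m with
  | zero => simp
  | succ m ih =>
    rw [Nat.mul_succ, sum_range_succ, sum_range_succ, sum_range_succ, sum_range_succ, ih]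
    simp only [add_assoc]

lemma eval_wheel (hw : w ^ 2 + w + 1 = 0) {H : ℂ[X]} {M : ℕ} (hH : H.degree < 3 * M + 2)
    (x : ℂ) :
    H.eval x + w * H.eval (w * x) + w ^ 2 * H.eval (w ^ 2 * x) =
      3 * x ^ 2 * (∑ i ∈ range M, C (H.coeff (3 * i + 2)) * X ^ i).eval (x ^ 3) := by
  have hw3 : w ^ 3 = 1 := by linear_combination (w - 1) * hw
  have hdeg : H.natDegree < 3 * (M + 1) := by
    by_cases h0 : H = 0
    · simp [h0]
    · rw [degree_eq_natDegree h0] at hH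
      have : H.natDegree < 3 * M + 2 := by exact_mod_cast hH
      omega
  have hlast : H.coeff (3 * M + 2) = 0 :=
    coeff_eq_zero_of_degree_lt (by exact_mod_cast hH)
  simp only [eval_eq_sum_range' hdeg, sum_range_three_mul, mul_sum, ← sum_add_distrib,
    eval_finsetSum, eval_mul, eval_C, eval_pow, eval_X]
  rw [sum_range_succ, hlast, ← add_zero (∑ i ∈ range M, 3 * x ^ 2 * _)]
  have hpow : ∀ i : ℕ, w ^ (3 * i) = 1 := fun i => by rw [pow_mul, hw3, one_pow]
  have hpow' : ∀ i : ℕ, w ^ (2 * (3 * i)) = 1 := fun i => by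
    rw [mul_comm, pow_mul, hpow, one_pow]
  congr 1
  · refine sum_congr rfl fun i _ => ?_
    simp only [mul_pow, pow_add, ← pow_mul, hpow, hpow']
    grind
  · simp only [mul_pow, pow_add, ← pow_mul, hpow, hpow']
    grind

lemma coeff_eq_zero_of_wheel (hw : w ^ 2 + w + 1 = 0) {H : ℂ[X]} {M : ℕ}
    (hH : H.degree < 3 * M + 2) {us : List ℂ} (hlen : us.length = M)
    (hnodup : (us.map (· ^ 3)).Nodup) (hne : ∀ u ∈ us, u ≠ 0)
    (hus : ∀ u ∈ us, H.eval u + w * H.eval (w * u) + w ^ 2 * H.eval (w ^ 2 * u) = 0) (i : ℕ) :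
    H.coeff (3 * i + 2) = 0 := by
  set g : ℂ[X] := ∑ i ∈ range M, C (H.coeff (3 * i + 2)) * X ^ i with hg
  have hcoeff : ∀ i, g.coeff i = if i < M then H.coeff (3 * i + 2) else 0 := fun i => by
    simp [hg, coeff_C_mul, coeff_X_pow]
  have hg0 : g = 0 := by
    refine eq_zero_of_degree_lt_of_eval_finset_eq_zero (us.map (· ^ 3)).toFinset ?_ ?_
    · rw [List.toFinset_card_of_nodup hnodup, List.length_map, hlen, degree_lt_iff_coeff_zero]
      intro m hm
      rw [hcoeff, if_neg (by omega)]
    · intro v hv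
      obtain ⟨u, hu, rfl⟩ : ∃ u ∈ us, u ^ 3 = v := by simpa using hv
      have := hus u hu
      rw [eval_wheel hw hH] at this
      have hu0 := hne u hu
      simpa [hu0] using this
  by_cases hi : i < M
  · have := hcoeff i
    rw [hg0, if_pos hi] at this
    simpa using this.symm
  · refine coeff_eq_zero_of_degree_lt (hH.trans_le ?_)
    exact_mod_cast (by omega : 3 * M + 2 ≤ 3 * i + 2)

/-- The geometric list `s, s ^ 2, …, s ^ M`. -/
noncomputable def geomList (M : ℕ) (s : ℝ) : List ℂ :=
  (List.range M).map fun j => ((s ^ (j + 1) : ℝ) : ℂ)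

lemma geomList_map_nodup (M : ℕ) {s : ℝ} (hs : 1 < s) {f : ℝ → ℝ}
    (hf : Set.InjOn f (Set.Ioi 0)) {F : ℂ → ℂ} (hF : ∀ x : ℝ, F x = f x) :
    ((geomList M s).map F).Nodup := by
  rw [geomList, List.map_map]
  refine (List.nodup_range).map fun a b hab => ?_
  simp only [Function.comp_apply, hF, Complex.ofReal_inj] at hab
  have := hf (Set.mem_Ioi.2 (by positivity)) (Set.mem_Ioi.2 (by positivity)) hab
  have := (pow_right_injective₀ (by linarith) hs.ne') this
  omega

lemma sub_ne_zero_of_pos (hw : w ^ 2 + w + 1 = 0) {a b : ℝ} (hb : 0 < b) :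
    (a : ℂ) - w ^ 2 * b ≠ 0 := by
  intro h
  have hb' : (b : ℂ) ≠ 0 := by exact_mod_cast hb.ne'
  have h₁ : w ^ 2 = ((a / b : ℝ) : ℂ) := by
    push_cast
    field_simp
    linear_combination -h
  have h₂ : w = ((-(a / b) - 1 : ℝ) : ℂ) := by
    push_cast at h₁ ⊢
    linear_combination hw - h₁
  have h₃ : ((-(a / b) - 1 : ℝ) : ℂ) ^ 2 + ((-(a / b) - 1 : ℝ) : ℂ) + 1 = 0 := by rw [← h₂, hw]
  have h₄ : (-(a / b) - 1 : ℝ) ^ 2 + (-(a / b) - 1 : ℝ) + 1 = 0 := by exact_mod_cast h₃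
  nlinarith [sq_nonneg (-(a / b) - 1 + 1 / 2)]

lemma mem_geomList {M : ℕ} {s : ℝ} (hs : 1 < s) {x : ℂ} (hx : x ∈ geomList M s) :
    ∃ a : ℝ, 0 < a ∧ x = a := by
  obtain ⟨j, -, rfl⟩ := List.mem_map.1 hx
  exact ⟨_, by positivity, rfl⟩

lemma wheelFn_geomList (hw : w ^ 2 + w + 1 = 0) (M : ℕ) {s : ℝ} (hs : 1 < s) (x : ℂ) :
    wheelFn w (geomList M s) x + w * wheelFn w (geomList M s) (w * x) +
      w ^ 2 * wheelFn w (geomList M s) (w ^ 2 * x) = 0 := by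
  have hlen : (geomList M s).length = M := by simp [geomList]
  have hne : ∀ y ∈ geomList M s, y ≠ 0 := fun y hy => by
    obtain ⟨a, ha, rfl⟩ := mem_geomList hs hy
    exact_mod_cast ha.ne'
  have hgen : ∀ x ∈ geomList M s, ∀ y ∈ geomList M s, x - w ^ 2 * y ≠ 0 := fun x hx y hy => by
    obtain ⟨a, -, rfl⟩ := mem_geomList hs hx
    obtain ⟨b, hb, rfl⟩ := mem_geomList hs hy
    exact sub_ne_zero_of_pos hw hb
  obtain ⟨H, hdeg, hH⟩ := exists_polynomial_wheelFn (w := w) (geomList M s)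
  rw [hlen] at hdeg
  have hcoeff : ∀ i, H.coeff (3 * i + 2) = 0 := by
    refine coeff_eq_zero_of_wheel (us := (geomList M s).map (·⁻¹)) hw hdeg (by simp [hlen]) ?_
      ?_ ?_
    · rw [List.map_map]
      refine geomList_map_nodup M hs (f := fun x => x⁻¹ ^ 3) ?_ fun x => by simp
      intro a ha b hb hab
      have := (pow_left_inj₀ (inv_nonneg.2 (le_of_lt ha)) (inv_nonneg.2 (le_of_lt hb))
        three_ne_zero).1 hab
      exact inv_injective this
    · intro u hu
      obtain ⟨y, hy, rfl⟩ := List.mem_map.1 hu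
      exact inv_ne_zero (hne y hy)
    · intro u hu
      obtain ⟨y, hy, rfl⟩ := List.mem_map.1 hu
      simp only [← hH]
      exact wheelFn_wheel hw _ hne hgen hy
  simp only [hH, eval_wheel hw hdeg, hcoeff]
  simp

lemma continuous_rowTransfer {S : Type*} [TopologicalSpace S] {x : S → ℂ} (hx : Continuous x)
    (h : Bool) (L : List (S → ℂ)) (hL : ∀ f ∈ L, Continuous f) (vs : List Bool)
    {k : S → List Bool → ℂ} (hk : ∀ l, Continuous fun s => k s l) :
    Continuous fun s => rowTransfer w (x s) h (L.map (· s)) vs (k s) := by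
  induction L generalizing h vs k with
  | nil =>
    cases vs <;> cases h <;> simp [rowTransfer, continuous_const, hk]
  | cons f L ih =>
    cases vs with
    | nil => simp [rowTransfer, continuous_const]
    | cons v vs =>
      have hf : Continuous f := hL f (by simp)
      simp only [List.map_cons, rowTransfer]
      refine continuous_finsetSum _ fun h' _ => continuous_finsetSum _ fun v' _ =>
        Continuous.mul ?_ (ih _ (fun g hg => hL g (by simp [hg])) _ fun l => hk _)
      cases h <;> cases v <;> cases h' <;> cases v' <;> simp only [vertexWeight] <;> fun_prop

lemma continuous_partitionFn {S : Type*} [TopologicalSpace S] (L : List (S → ℂ))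
    (hL : ∀ f ∈ L, Continuous f) (vs : List Bool) :
    Continuous fun s => partitionFn w (L.map (· s)) vs := by
  induction L generalizing vs with
  | nil => cases vs <;> simp [partitionFn, continuous_const]
  | cons f L ih =>
    cases vs with
    | nil => simp [partitionFn, continuous_const]
    | cons v vs =>
      simp only [List.map_cons, partitionFn]
      exact continuous_rowTransfer (hL f (by simp)) _ _ (fun g hg => hL g (by simp [hg])) _
        fun l => ih (fun g hg => hL g (by simp [hg])) l

lemma wheelFn_replicate_one (hw : w ^ 2 + w + 1 = 0) (M : ℕ) (x : ℂ) :
    wheelFn w (List.replicate M 1) x + w * wheelFn w (List.replicate M 1) (w * x) +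
      w ^ 2 * wheelFn w (List.replicate M 1) (w ^ 2 * x) = 0 := by
  have hcont : ∀ x : ℂ, ContinuousOn (fun s : ℝ => wheelFn w (geomList M s) x) (Set.Ioi 0) := by
    intro x
    unfold wheelFn
    refine ContinuousOn.mul ?_ (continuousOn_const.mul ?_)
    · have := continuous_partitionFn (w := w) ((fun _ : ℝ => x) ::
        (List.range M).map fun j (s : ℝ) => ((s ^ (j + 1) : ℝ) : ℂ)) (fun f hf => by
          simp only [List.mem_cons, List.mem_map] at hf
          obtain rfl | ⟨j, -, rfl⟩ := hf <;> fun_prop) (List.replicate (M + 1) false)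
      simp only [List.map_cons, List.map_map] at this
      simpa [geomList, Function.comp_def] using this.continuousOn
    · simp only [geomList, List.map_map]
      refine continuousOn_list_prod _ fun j _ => ?_
      simp only [Function.comp_def]
      refine ContinuousOn.mul (by fun_prop) (continuousOn_const.sub (ContinuousOn.inv₀ ?_ ?_))
      · fun_prop
      · intro s hs
        have : 0 < s := hs
        exact_mod_cast (pow_pos this _).ne'
  have h₁ : geomList M 1 = List.replicate M 1 := by
    simp [geomList]
  have hzero : ContinuousOn (fun s : ℝ => wheelFn w (geomList M s) x +
      w * wheelFn w (geomList M s) (w * x) + w ^ 2 * wheelFn w (geomList M s) (w ^ 2 * x))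
      (Set.Ioi 0) :=
    ((hcont x).add (continuousOn_const.mul (hcont _))).add (continuousOn_const.mul (hcont _))
  have hat := (hzero.continuousAt (Ioi_mem_nhds one_pos)).tendsto.mono_left
    (nhdsWithin_le_nhds (s := Set.Ioi 1))
  rw [h₁] at hat
  refine tendsto_nhds_unique hat (tendsto_const_nhds.congr' ?_)
  filter_upwards [self_mem_nhdsWithin] with s hs
  exact (wheelFn_geomList hw M hs x).symm

/-- Coefficients of the specialisation of the wheel polynomial at the homogeneous point. -/
lemma exists_homogeneous_polynomial (hw : w ^ 2 + w + 1 = 0) (M : ℕ) :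
    ∃ p : ℂ[X], (∀ x, partitionFn w (x :: List.replicate M 1) (List.replicate (M + 1) false) =
        p.eval x) ∧
      ((X - C 1) ^ (2 * M + 1) * ((X + C 1) * p)).degree < 3 * (M : WithBot ℕ) + 2 ∧
      ∀ i, ((X - C 1) ^ (2 * M + 1) * ((X + C 1) * p)).coeff (3 * i + 2) = 0 := by
  obtain ⟨p, hp, h⟩ := exists_polynomial_rowTransfer (w := w) (List.replicate M 1)
    (partitionFn w (List.replicate M 1))
  simp only [List.length_replicate] at hp h
  obtain ⟨H, hdeg, hH⟩ := exists_polynomial_wheelFn (w := w) (List.replicate M 1)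
  rw [List.length_replicate] at hdeg
  have hZ : ∀ x, partitionFn w (x :: List.replicate M 1) (List.replicate (M + 1) false) =
      p.eval x := fun x => by rw [List.replicate_succ, partitionFn, h]
  have hEq : H = (X - C 1) ^ (2 * M + 1) * ((X + C 1) * p) := by
    refine Polynomial.funext fun x => ?_
    rw [← hH, wheelFn, List.length_replicate, hZ]
    simp only [inv_one, List.map_replicate, List.prod_replicate, eval_mul, eval_pow, eval_sub,
      eval_add, eval_X, eval_C]
    rw [← pow_two (x - 1), ← pow_mul]
    ring
  refine ⟨p, hZ, hEq ▸ hdeg, ?_⟩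
  rw [← hEq]
  refine coeff_eq_zero_of_wheel (us := geomList M 2) hw hdeg (by simp [geomList]) ?_ ?_ ?_
  · refine geomList_map_nodup M one_lt_two (f := fun x => x ^ 3) ?_ fun x => by simp
    intro a ha b hb hab
    exact (pow_left_inj₀ (le_of_lt ha) (le_of_lt hb) three_ne_zero).1 hab
  · intro u hu
    obtain ⟨a, ha, rfl⟩ := mem_geomList one_lt_two hu
    exact_mod_cast ha.ne'
  · intro u _
    simp only [← hH]
    exact wheelFn_replicate_one hw M u

end Homogeneous

section CoefficientExtraction

open Polynomial

lemma sum_X_sub_one_mul (φ : ℂ → ℂ) (Q : ℂ[X]) :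
    ((X - C 1) * Q).sum (fun e c => c * φ e) = Q.sum (fun e c => c * fwdDiff 1 φ e) := by
  induction Q using Polynomial.induction_on' with
  | add p q hp hq =>
    rw [mul_add, sum_add_index _ _ _ (by simp) (by intros; ring), hp, hq,
      sum_add_index _ _ _ (by simp) (by intros; ring)]
  | monomial n a =>
    rw [sub_mul, X_mul_monomial, C_mul_monomial, one_mul, sub_eq_add_neg, ← monomial_neg,
      sum_add_index _ _ _ (by simp) (by intros; ring),
      sum_monomial_index _ _ (by simp), sum_monomial_index _ _ (by simp),
      sum_monomial_index _ _ (by simp)]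
    simp only [fwdDiff]
    push_cast
    ring

lemma sum_X_sub_one_pow_mul (L : ℕ) (φ : ℂ → ℂ) (Q : ℂ[X]) :
    ((X - C 1) ^ L * Q).sum (fun e c => c * φ e) = Q.sum (fun e c => c * ((fwdDiff 1)^[L] φ) e) := by
  induction L generalizing φ with
  | zero => simp
  | succ L ih => rw [pow_succ', mul_assoc, sum_X_sub_one_mul, ih, Function.iterate_succ_apply]

/-- The coefficients of a polynomial with a zero of order `L` at `1` and only `L + 1` possible
exponents are given by Lagrange interpolation. -/
lemma coeff_mul_prod_eq {L : ℕ} {Q : ℂ[X]} {E : Finset ℕ} (hE : E.card = L + 1)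
    (hsupp : ∀ e ∉ E, ((X - C 1) ^ L * Q).coeff e = 0) {e₀ : ℕ} (he₀ : e₀ ∈ E) :
    ((X - C 1) ^ L * Q).coeff e₀ * ∏ e ∈ E.erase e₀, ((e₀ : ℂ) - e) =
      L.factorial * Q.eval 1 := by
  set f : ℂ[X] := ∏ e ∈ E.erase e₀, (X - C (e : ℂ)) with hf
  have hmonic : f.Monic := monic_prod_X_sub_C _ _
  have hdeg : f.natDegree = L := by
    rw [hf, natDegree_finsetProd_X_sub_C_eq_card, card_erase_of_mem he₀, hE, Nat.add_sub_cancel]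
  have hdiff : (fwdDiff 1)^[L] f.eval = fun _ => (L.factorial : ℂ) := by
    have := f.fwdDiff_iter_degree_eq_factorial
    rw [hmonic.leadingCoeff, one_smul, hdeg] at this
    exact this
  have key := sum_X_sub_one_pow_mul L f.eval Q
  rw [hdiff] at key
  have hR : Q.sum (fun e c => c * (L.factorial : ℂ)) = L.factorial * Q.eval 1 := by
    rw [eval_eq_sum, Polynomial.sum, Polynomial.sum, mul_sum]
    exact sum_congr rfl fun e _ => by rw [one_pow]; ring
  rw [← hR, ← key, Polynomial.sum, sum_eq_single e₀]
  · rw [hf, eval_prod]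
    simp
  · intro e _ hne
    by_cases heE : e ∈ E
    · rw [hf, eval_prod, prod_eq_zero (mem_erase.2 ⟨hne, heE⟩) (by simp), mul_zero]
    · rw [hsupp e heE, zero_mul]
  · intro h
    rw [notMem_support_iff.1 h, zero_mul]

end CoefficientExtraction

section Exponents

/-- The exponents up to `3 * M + 1` that are not congruent to `2` modulo `3`. -/
def exponentSet (M : ℕ) : Finset ℕ := {e ∈ range (3 * M + 2) | e % 3 ≠ 2}

lemma mem_exponentSet {M e : ℕ} : e ∈ exponentSet M ↔ e < 3 * M + 2 ∧ e % 3 ≠ 2 := by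
  simp [exponentSet]

@[to_additive]
lemma prod_exponentSet {R : Type*} [CommMonoid R] (M : ℕ) (f : ℕ → R) :
    ∏ e ∈ exponentSet M, f e = ∏ j ∈ range (M + 1), f (3 * j) * f (3 * j + 1) := by
  induction M with
  | zero =>
    rw [exponentSet, filter_true_of_mem (by simp; omega)]
    simp [prod_range_succ]
  | succ M ih =>
    rw [prod_range_succ, ← ih]
    simp only [exponentSet]
    rw [show 3 * (M + 1) + 2 = 3 * M + 2 + 1 + 1 + 1 by ring, range_add_one, filter_insert,
      if_pos (by omega), prod_insert (by simp), range_add_one, filter_insert, if_pos (by omega),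
      prod_insert (by simp), range_add_one, filter_insert, if_neg (by omega), mul_comm _ (f _ * _),
      mul_left_comm, mul_assoc]
    rfl

lemma card_exponentSet (M : ℕ) : (exponentSet M).card = 2 * M + 1 + 1 := by
  rw [card_eq_sum_ones, sum_exponentSet]
  simp
  ring

lemma prod_range_erase_sub {M j : ℕ} (hj : j ≤ M) :
    ∏ i ∈ (range (M + 1)).erase j, ((j : ℂ) - i) =
      (-1) ^ (M - j) * j.factorial * (M - j).factorial := by
  obtain ⟨k, rfl⟩ := Nat.exists_eq_add_of_le hj
  have hsplit : (range (j + k + 1)).erase j =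
      (range j).disjUnion ((range k).map (addLeftEmbedding (j + 1))) (by
        simp only [disjoint_left, mem_range, mem_map, addLeftEmbedding_apply]
        rintro a ha ⟨b, -, rfl⟩
        omega) := by
    ext i
    simp only [mem_erase, mem_range, mem_disjUnion, mem_map, addLeftEmbedding_apply]
    constructor
    · intro h
      by_cases hij : i < j
      · exact Or.inl hij
      · exact Or.inr ⟨i - (j + 1), by omega, by omega⟩
    · rintro (h | ⟨b, hb, rfl⟩) <;> omega
  rw [hsplit, prod_disjUnion, prod_map, Nat.add_sub_cancel_left]
  have h₁ : ∏ i ∈ range j, ((j : ℂ) - i) = j.factorial := by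
    rw [← prod_range_reflect, ← prod_range_add_one_eq_factorial, Nat.cast_prod]
    refine prod_congr rfl fun i hi => ?_
    rw [mem_range] at hi
    rw [show j - 1 - i = j - (i + 1) by omega, Nat.cast_sub (by omega)]
    ring
  have h₂ : ∏ i ∈ range k, ((j : ℂ) - (addLeftEmbedding (j + 1) i : ℕ)) =
      (-1) ^ k * k.factorial := by
    have hone : (-1 : ℂ) ^ k = ∏ _i ∈ range k, (-1 : ℂ) := by rw [prod_const, card_range]
    rw [← prod_range_add_one_eq_factorial, Nat.cast_prod, hone, ← prod_mul_distrib]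
    refine prod_congr rfl fun i _ => ?_
    simp only [addLeftEmbedding_apply]
    push_cast
    ring
  rw [h₁, h₂]
  ring

lemma prod_exponentSet_erase {M j : ℕ} (hj : j ≤ M) :
    ∏ e ∈ (exponentSet M).erase (3 * j), (((3 * j : ℕ) : ℂ) - e) =
      3 ^ M * ((-1) ^ (M - j) * j.factorial * (M - j).factorial) *
        ∏ i ∈ range (M + 1), (3 * ((j : ℂ) - i) - 1) := by
  have hmem : 3 * j ∈ exponentSet M := mem_exponentSet.2 ⟨by omega, by omega⟩
  have hjmem : j ∈ range (M + 1) := mem_range.2 (by omega)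
  have h₁ : ∏ e ∈ (exponentSet M).erase (3 * j), (((3 * j : ℕ) : ℂ) - e) =
      ∏ e ∈ exponentSet M, if e = 3 * j then 1 else (((3 * j : ℕ) : ℂ) - e) := by
    rw [← mul_prod_erase _ _ hmem, if_pos rfl, one_mul]
    exact prod_congr rfl fun e he => (if_neg (mem_erase.1 he).1).symm
  have h₂ : ∏ i ∈ range (M + 1), (if 3 * i = 3 * j then 1 else (((3 * j : ℕ) : ℂ) - (3 * i : ℕ))) =
      ∏ i ∈ (range (M + 1)).erase j, 3 * ((j : ℂ) - i) := by
    rw [← mul_prod_erase _ _ hjmem, if_pos rfl, one_mul]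
    refine prod_congr rfl fun e he => ?_
    have := (mem_erase.1 he).1
    rw [if_neg (by omega)]
    push_cast
    ring
  rw [h₁, prod_exponentSet, prod_mul_distrib, h₂, prod_mul_distrib, prod_const,
    prod_range_erase_sub hj, card_erase_of_mem hjmem, card_range, Nat.add_sub_cancel]
  congr 1
  refine prod_congr rfl fun i _ => ?_
  rw [if_neg (by omega)]
  push_cast
  ring

lemma prod_exponentSet_erase_reflect {M e₀ : ℕ} (he₀ : e₀ ∈ exponentSet M) :
    ∏ e ∈ (exponentSet M).erase (3 * M + 1 - e₀), (((3 * M + 1 - e₀ : ℕ) : ℂ) - e) =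
      -∏ e ∈ (exponentSet M).erase e₀, ((e₀ : ℂ) - e) := by
  have h₀ := mem_exponentSet.1 he₀
  have : ∏ e ∈ (exponentSet M).erase e₀, -((e₀ : ℂ) - e) =
      -∏ e ∈ (exponentSet M).erase e₀, ((e₀ : ℂ) - e) := by
    rw [prod_neg, card_erase_of_mem he₀, card_exponentSet, Nat.add_sub_cancel,
      Odd.neg_one_pow ⟨M, rfl⟩, neg_one_mul]
  rw [← this]
  refine prod_nbij' (fun e => 3 * M + 1 - e) (fun e => 3 * M + 1 - e) ?_ ?_ ?_ ?_ ?_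
  · intro e he
    simp only [mem_erase, mem_exponentSet] at he ⊢
    omega
  · intro e he
    simp only [mem_erase, mem_exponentSet] at he ⊢
    omega
  · intro e he
    simp only [mem_erase, mem_exponentSet] at he
    omega
  · intro e he
    simp only [mem_erase, mem_exponentSet] at he
    omega
  · intro e he
    simp only [mem_erase, mem_exponentSet] at he
    rw [Nat.cast_sub (by omega), Nat.cast_sub (by omega)]
    ring

lemma prod_three_mul_sub_one (M j : ℕ) :
    (∏ i ∈ range (M + 1), (3 * ((j : ℂ) - i) - 1)) * ∏ i ∈ range j, (-(M : ℂ) - 1 / 3 + i) =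
      (∏ i ∈ range (M + 1), (3 * (0 - (i : ℂ)) - 1)) * ∏ i ∈ range j, ((2 : ℂ) / 3 + i) := by
  induction j with
  | zero => simp
  | succ j ih =>
    have hrec : (∏ i ∈ range (M + 1), (3 * (((j + 1 : ℕ) : ℂ) - i) - 1)) * (3 * ((j : ℂ) - M) - 1) =
        (∏ i ∈ range (M + 1), (3 * ((j : ℂ) - i) - 1)) * (3 * j + 2) := by
      rw [prod_range_succ', prod_range_succ]
      have : ∀ i ∈ range M, (3 * (((j + 1 : ℕ) : ℂ) - (i + 1 : ℕ)) - 1) = 3 * ((j : ℂ) - i) - 1 :=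
        fun i _ => by push_cast; ring
      rw [prod_congr rfl this]
      push_cast
      ring
    rw [prod_range_succ _ j, prod_range_succ _ j]
    linear_combination (∏ i ∈ range j, (-(M : ℂ) - 1 / 3 + i)) / 3 * hrec + (2 / 3 + (j : ℂ)) * ih

end Exponents

section Hypergeometric

/-- The Chu-Vandermonde sum. -/
lemma sum_choose_mul_prod_div (M : ℕ) (a b : ℂ) (hb : ∀ i : ℕ, b + i ≠ 0) :
    ∑ j ∈ range (M + 1), (-1) ^ j * (M.choose j : ℂ) *
        ((∏ i ∈ range j, (a + i)) / ∏ i ∈ range j, (b + i)) =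
      (∏ i ∈ range M, (b - a + i)) / ∏ i ∈ range M, (b + i) := by
  induction M generalizing a b with
  | zero => simp
  | succ M ih =>
    have hb' : ∀ i : ℕ, b + 1 + i ≠ 0 := fun i => by
      have := hb (i + 1)
      push_cast at this
      rwa [add_assoc, add_comm (1 : ℂ)]
    have hshift : ∀ (c : ℂ) (j : ℕ), ∏ i ∈ range (j + 1), (c + i) =
        c * ∏ i ∈ range j, (c + 1 + i) := fun c j => by
      rw [prod_range_succ', mul_comm, Nat.cast_zero, add_zero]
      refine congrArg _ (prod_congr rfl fun i _ => ?_)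
      push_cast
      ring
    have hb0 : b ≠ 0 := by simpa using hb 0
    have hprod : ∀ j, ∏ i ∈ range j, (b + i) ≠ 0 := fun j => prod_ne_zero_iff.2 fun i _ => hb i
    have hprod' : ∀ j, ∏ i ∈ range j, (b + 1 + i) ≠ 0 :=
      fun j => prod_ne_zero_iff.2 fun i _ => hb' i
    have hpascal : ∑ j ∈ range (M + 1 + 1), (-1) ^ j * ((M + 1).choose j : ℂ) *
          ((∏ i ∈ range j, (a + i)) / ∏ i ∈ range j, (b + i)) =
        ∑ j ∈ range (M + 1), (-1) ^ j * (M.choose j : ℂ) *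
          ((∏ i ∈ range j, (a + i)) / ∏ i ∈ range j, (b + i)) -
        a / b * ∑ j ∈ range (M + 1), (-1) ^ j * (M.choose j : ℂ) *
          ((∏ i ∈ range j, (a + 1 + i)) / ∏ i ∈ range j, (b + 1 + i)) := by
      have h₁ : ∑ j ∈ range (M + 1), (-1) ^ j * (M.choose j : ℂ) *
          ((∏ i ∈ range j, (a + i)) / ∏ i ∈ range j, (b + i)) =
          ∑ j ∈ range (M + 1), (-1) ^ (j + 1) * (M.choose (j + 1) : ℂ) *
          ((∏ i ∈ range (j + 1), (a + i)) / ∏ i ∈ range (j + 1), (b + i)) + 1 := by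
        rw [sum_range_succ', sum_range_succ _ M]
        simp
      rw [sum_range_succ', h₁, mul_sum, add_sub_right_comm, ← sum_sub_distrib]
      congr 1
      · refine sum_congr rfl fun j _ => ?_
        rw [hshift, hshift, Nat.choose_succ_succ]
        push_cast
        field_simp
        ring
      · simp
    rw [hpascal, ih a b hb, ih (a + 1) (b + 1) hb', add_sub_add_right_eq_sub,
      prod_range_succ _ M]
    have h₂ := hshift b M
    have h₃ := h₂
    rw [prod_range_succ] at h₃
    rw [h₂]
    have hM := hb M
    have : (∏ i ∈ range M, (b - a + i)) / ∏ i ∈ range M, (b + i) =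
        (b + M) * (∏ i ∈ range M, (b - a + i)) / (b * ∏ i ∈ range M, (b + 1 + i)) := by
      rw [← h₃]
      field_simp [hprod M]
    rw [this]
    field_simp [hprod' M]
    ring

/-- A terminating well-poised sum. -/
lemma sum_wellPoised (M : ℕ) (a : ℂ) (ha : ∀ i : ℕ, 1 + a + i ≠ 0) :
    (∑ j ∈ range (M + 1), (M.choose j : ℂ) * (a + 2 * j) *
        ((∏ i ∈ range j, (a + i)) / ∏ i ∈ range (M + j), (1 + a + i))) *
      ∏ i ∈ range M, (1 + a + 2 * i) = 2 ^ M * a := by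
  induction M with
  | zero => simp
  | succ M ih =>
    set r : ℕ → ℂ := fun j => ∏ i ∈ range j, (a + i) with hr
    set s : ℕ → ℂ := fun j => ∏ i ∈ range j, (1 + a + i) with hs
    have hr1 : ∀ j, r (j + 1) = r j * (a + j) := fun j => prod_range_succ _ _
    have hs1 : ∀ j, s (j + 1) = s j * (1 + a + j) := fun j => prod_range_succ _ _
    have hs0 : ∀ j, s j ≠ 0 := fun j => prod_ne_zero_iff.2 fun i _ => ha i
    let g : ℕ → ℂ := fun j => Nat.casesOn j 0 fun j =>
      -(1 + a + 2 * j) * (M.choose j : ℂ) * (r (j + 1) / s (M + (j + 1)))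
    have hg0 : g 0 = 0 := rfl
    have hg1 : ∀ j, g (j + 1) =
      -(1 + a + 2 * j) * (M.choose j : ℂ) * (r (j + 1) / s (M + (j + 1))) := fun _ => rfl
    have hstep : ∀ j, (1 + a + 2 * M) * (((M + 1).choose j : ℂ) * (a + 2 * j) *
        (r j / s (M + 1 + j))) - 2 * ((M.choose j : ℂ) * (a + 2 * j) * (r j / s (M + j))) =
        g (j + 1) - g j := by
      intro j
      have hj := ha (M + j)
      push_cast at hj
      have hsj := hs0 (M + j)
      cases j with
      | zero =>
        rw [hg0, hg1, hr1, show M + 1 + 0 = M + 0 + 1 by ring, show M + (0 + 1) = M + 0 + 1 by ring, hs1]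
        simp only [Nat.choose_zero_right]
        push_cast at hj ⊢
        rw [add_zero] at hj hsj ⊢
        field_simp
        ring
      | succ j =>
        rw [hg1, hg1, hr1 (j + 1), show M + 1 + (j + 1) = M + (j + 1) + 1 by ring,
          show M + (j + 1 + 1) = M + (j + 1) + 1 by ring, hs1 (M + (j + 1)),
          Nat.choose_succ_succ]
        have hchoose : (M.choose (j + 1) : ℂ) * (j + 1) = M.choose j * (M - j) := by
          rcases le_or_gt j M with h | h
          · have := Nat.choose_succ_right_eq M j
            rw [← Nat.cast_sub h]
            exact_mod_cast this
          · rw [Nat.choose_eq_zero_of_lt h, Nat.choose_eq_zero_of_lt (by omega)]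
            simp
        push_cast at hj ⊢
        field_simp
        linear_combination -(a + 2 * j + 3) * r (j + 1) * hchoose
    have hsum := sum_range_sub g (M + 2)
    rw [← sum_congr rfl fun j _ => hstep j, sum_sub_distrib, ← mul_sum, ← mul_sum, hg0, hg1,
      sum_range_succ (fun j => (M.choose j : ℂ) * (a + 2 * j) * (r j / s (M + j))) (M + 1),
      Nat.choose_succ_self] at hsum
    rw [prod_range_succ _ M]
    simp only [Nat.cast_zero, mul_zero, zero_mul, add_zero, sub_zero] at hsum
    linear_combination (∏ i ∈ range M, (1 + a + 2 * (i : ℂ))) * hsum + 2 * ih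

end Hypergeometric

section SpecialValues

open Polynomial

variable {M : ℕ} {Q : ℂ[X]}

lemma coeff_three_mul (hsupp : ∀ e ∉ exponentSet M, ((X - C 1) ^ (2 * M + 1) * Q).coeff e = 0)
    {j : ℕ} (hj : j ≤ M) :
    ((X - C 1) ^ (2 * M + 1) * Q).coeff (3 * j) *
        (3 ^ M * M.factorial * ∏ i ∈ range (M + 1), (3 * (i : ℂ) + 1)) =
      -((2 * M + 1).factorial * Q.eval 1) * ((-1) ^ j * (M.choose j : ℂ) *
        ((∏ i ∈ range j, (-(M : ℂ) - 1 / 3 + i)) / ∏ i ∈ range j, ((2 : ℂ) / 3 + i))) := by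
  have h := coeff_mul_prod_eq (card_exponentSet M) hsupp
    (mem_exponentSet.2 (⟨by omega, by omega⟩ : 3 * j < 3 * M + 2 ∧ 3 * j % 3 ≠ 2))
  rw [prod_exponentSet_erase hj] at h
  have hP := prod_three_mul_sub_one M j
  have hP₀ : ∏ i ∈ range (M + 1), (3 * (0 - (i : ℂ)) - 1) =
      (-1) ^ (M + 1) * ∏ i ∈ range (M + 1), (3 * (i : ℂ) + 1) := by
    have hone : (-1 : ℂ) ^ (M + 1) = ∏ _i ∈ range (M + 1), (-1 : ℂ) := by
      rw [prod_const, card_range]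
    rw [hone, ← prod_mul_distrib]
    exact prod_congr rfl fun i _ => by ring
  have hfac : (M.choose j : ℂ) * j.factorial * (M - j).factorial = M.factorial := by
    exact_mod_cast Nat.choose_mul_factorial_mul_factorial hj
  have hb : ∏ i ∈ range j, ((2 : ℂ) / 3 + i) ≠ 0 := by
    refine prod_ne_zero_iff.2 fun i _ => ?_
    have : ((3 * i + 2 : ℕ) : ℂ) ≠ 0 := Nat.cast_ne_zero.2 (by omega)
    intro h
    exact this (by push_cast; linear_combination 3 * h)
  obtain ⟨k, rfl⟩ := Nat.exists_eq_add_of_le hj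
  rw [Nat.add_sub_cancel_left] at h hfac
  rw [hP₀] at hP
  have hsign : ((-1 : ℂ) ^ j * (-1) ^ k) * ((-1) ^ j * (-1) ^ k) = 1 := by
    rw [← pow_add, ← pow_add]
    exact Even.neg_one_pow ⟨_, rfl⟩
  rw [← hfac]
  rw [mul_div_assoc', mul_div_assoc', eq_div_iff hb]
  rw [pow_succ, pow_add] at hP
  linear_combination -(-1) ^ j * ((j + k).choose j : ℂ) *
      (∏ i ∈ range j, (-((j + k : ℕ) : ℂ) - 1 / 3 + i)) * h +
    ((X - C 1) ^ (2 * (j + k) + 1) * Q).coeff (3 * j) * 3 ^ (j + k) *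
      ((j + k).choose j * j.factorial * k.factorial) * ((-1) ^ j * (-1) ^ k) * hP -
    ((X - C 1) ^ (2 * (j + k) + 1) * Q).coeff (3 * j) * 3 ^ (j + k) *
      ((j + k).choose j * j.factorial * k.factorial) *
      (∏ i ∈ range (j + k + 1), (3 * (i : ℂ) + 1)) * (∏ i ∈ range j, ((2 : ℂ) / 3 + i)) * hsign

lemma coeff_reflect (hsupp : ∀ e ∉ exponentSet M, ((X - C 1) ^ (2 * M + 1) * Q).coeff e = 0)
    {e₀ : ℕ} (he₀ : e₀ ∈ exponentSet M) :
    ((X - C 1) ^ (2 * M + 1) * Q).coeff (3 * M + 1 - e₀) =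
      -((X - C 1) ^ (2 * M + 1) * Q).coeff e₀ := by
  have hmem := mem_exponentSet.1 he₀
  have h := coeff_mul_prod_eq (card_exponentSet M) hsupp he₀
  have h' := coeff_mul_prod_eq (card_exponentSet M) hsupp
    (mem_exponentSet.2 (⟨by omega, by omega⟩ :
      3 * M + 1 - e₀ < 3 * M + 2 ∧ (3 * M + 1 - e₀) % 3 ≠ 2))
  rw [prod_exponentSet_erase_reflect he₀] at h'
  have hne : ∏ e ∈ (exponentSet M).erase e₀, ((e₀ : ℂ) - e) ≠ 0 :=
    prod_ne_zero_iff.2 fun e he =>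
      sub_ne_zero.2 fun hee => (mem_erase.1 he).1 (by exact_mod_cast hee.symm)
  refine mul_right_cancel₀ hne ?_
  linear_combination h - h'

lemma eq_sum_coeff_three_mul (hdeg : ((X - C 1) ^ (2 * M + 1) * Q).degree < 3 * (M : WithBot ℕ) + 2)
    (hsupp : ∀ e ∉ exponentSet M, ((X - C 1) ^ (2 * M + 1) * Q).coeff e = 0) :
    (X - C 1) ^ (2 * M + 1) * Q = ∑ j ∈ range (M + 1),
      C (((X - C 1) ^ (2 * M + 1) * Q).coeff (3 * j)) * (X ^ (3 * j) - X ^ (3 * (M - j) + 1)) := by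
  set H := (X - C 1) ^ (2 * M + 1) * Q
  have hsum : H = ∑ e ∈ exponentSet M, C (H.coeff e) * X ^ e := by
    have hnat : H.natDegree < 3 * M + 2 := by
      rcases eq_or_ne H 0 with h | h
      · rw [h, natDegree_zero]
        omega
      · rw [natDegree_lt_iff_degree_lt h]
        exact_mod_cast hdeg
    conv_lhs => rw [H.as_sum_range_C_mul_X_pow' hnat]
    refine (sum_subset (filter_subset _ _) fun e _ he => ?_).symm
    rw [show H.coeff e = 0 from hsupp e he, C_0, zero_mul]
  conv_lhs => rw [hsum, sum_exponentSet, sum_add_distrib,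
    ← sum_range_reflect (fun j => C (H.coeff (3 * j + 1)) * X ^ (3 * j + 1)), ← sum_add_distrib]
  refine sum_congr rfl fun j hj => ?_
  rw [mem_range] at hj
  have := coeff_reflect hsupp (mem_exponentSet.2 (⟨by omega, by omega⟩ :
    3 * j < 3 * M + 2 ∧ 3 * j % 3 ≠ 2))
  rw [show 3 * M + 1 - 3 * j = 3 * (M + 1 - 1 - j) + 1 by omega] at this
  rw [this, C_neg, Nat.add_sub_cancel]
  ring

end SpecialValues

section SpecialValueRatios

open Polynomial

variable {M : ℕ} {p : ℂ[X]}

lemma eval_sq_mul {w : ℂ} (hw : w ^ 2 + w + 1 = 0)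
    (hdeg : ((X - C 1) ^ (2 * M + 1) * ((X + C 1) * p)).degree < 3 * (M : WithBot ℕ) + 2)
    (hsupp : ∀ e ∉ exponentSet M, ((X - C 1) ^ (2 * M + 1) * ((X + C 1) * p)).coeff e = 0) :
    (w ^ 2 - 1) ^ (2 * M + 1) * ((w ^ 2 + 1) * p.eval (w ^ 2)) *
        (3 ^ M * M.factorial * ∏ i ∈ range (M + 1), (3 * (i : ℂ) + 1)) =
      (w ^ 2 - 1) * ((2 * M + 1).factorial * (2 * p.eval 1)) *
        ((∏ i ∈ range M, ((M : ℂ) + 1 + i)) / ∏ i ∈ range M, ((2 : ℂ) / 3 + i)) := by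
  have hw3 : w ^ 3 = 1 := by linear_combination (w - 1) * hw
  have h := congrArg (Polynomial.eval (w ^ 2)) (eq_sum_coeff_three_mul hdeg hsupp)
  have hvan := sum_choose_mul_prod_div M (-(M : ℂ) - 1 / 3) (2 / 3) fun i hi => by
    have : ((3 * i + 2 : ℕ) : ℂ) ≠ 0 := Nat.cast_ne_zero.2 (by omega)
    exact this (by push_cast; linear_combination 3 * hi)
  rw [show (2 : ℂ) / 3 - (-(M : ℂ) - 1 / 3) = M + 1 by ring] at hvan
  have hpow : ∀ i, (w ^ 2) ^ (3 * i) = 1 := fun i => by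
    rw [← pow_mul, show 2 * (3 * i) = 3 * (2 * i) by ring, pow_mul, hw3, one_pow]
  rw [eval_finsetSum] at h
  simp only [eval_mul, eval_pow, eval_sub, eval_add, eval_X, eval_C, pow_succ _ (3 * _), hpow,
    one_mul] at h
  rw [← sum_mul] at h
  rw [h, ← hvan, mul_right_comm, sum_mul,
    sum_congr rfl fun j hj => coeff_three_mul hsupp (mem_range_succ_iff.1 hj), ← mul_sum]
  simp only [eval_mul, eval_add, eval_X, eval_C]
  ring

lemma eval_neg_one_mul
    (hdeg : ((X - C 1) ^ (2 * M + 1) * ((X + C 1) * p)).degree < 3 * (M : WithBot ℕ) + 2)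
    (hsupp : ∀ e ∉ exponentSet M, ((X - C 1) ^ (2 * M + 1) * ((X + C 1) * p)).coeff e = 0)
    (hM : Odd M) :
    2 ^ (M + 1) * p.eval (-1) * (3 ^ M * M.factorial * ∏ i ∈ range (M + 1), (3 * (i : ℂ) + 1)) *
        ∏ i ∈ range M, ((2 : ℂ) / 3 - M + 2 * i) =
      ((2 * M + 1).factorial * (2 * p.eval 1)) * (3 * M + 1) *
        ∏ i ∈ range M, ((2 : ℂ) / 3 - M + i) := by
  have h := congrArg (fun q => (derivative q).eval (-1)) (eq_sum_coeff_three_mul hdeg hsupp)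
  have hL : ((derivative ((X - C 1) ^ (2 * M + 1) * ((X + C 1) * p))).eval (-1) : ℂ) =
      -(2 ^ (2 * M + 1) * p.eval (-1)) := by
    simp only [derivative_mul, derivative_add, derivative_X, derivative_C, eval_add, eval_mul,
      eval_pow, eval_sub, eval_X, eval_C]
    rw [show (-1 - 1 : ℂ) = -2 by norm_num, Odd.neg_pow ⟨M, rfl⟩]
    simp
  have hterm : ∀ j ∈ range (M + 1),
      (derivative (C (((X - C 1) ^ (2 * M + 1) * ((X + C 1) * p)).coeff (3 * j)) *
        (X ^ (3 * j) - X ^ (3 * (M - j) + 1)))).eval (-1) =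
      -3 * (((X - C 1) ^ (2 * M + 1) * ((X + C 1) * p)).coeff (3 * j) * ((-1) ^ j *
        (-(M : ℂ) - 1 / 3 + 2 * j))) := by
    intro j hj
    rw [mem_range_succ_iff] at hj
    have h₁ : ((3 * j : ℕ) : ℂ) * (-1) ^ (3 * j - 1) = -(3 * j * (-1) ^ j) := by
      cases j with
      | zero => simp
      | succ j =>
        rw [show 3 * (j + 1) - 1 = 2 * (j + 1) + j by omega, pow_add, pow_mul]
        push_cast
        ring
    have h₂ : (-1 : ℂ) ^ (3 * (M - j)) = -(-1) ^ j := by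
      obtain ⟨k, rfl⟩ := Nat.exists_eq_add_of_le hj
      rw [Nat.add_sub_cancel_left, pow_mul, show (-1 : ℂ) ^ 3 = -1 by norm_num]
      rcases Nat.even_or_odd j with he | ho
      · rw [he.neg_one_pow, (by grind : Odd k).neg_one_pow]
      · rw [ho.neg_one_pow, (by grind : Even k).neg_one_pow]
        norm_num
    simp only [derivative_C_mul, derivative_sub, derivative_X_pow, eval_mul, eval_sub, eval_pow,
      eval_C, eval_X, Nat.add_sub_cancel, h₁, h₂]
    push_cast [Nat.cast_sub hj]
    ring
  rw [hL, derivative_sum, eval_finsetSum, sum_congr rfl hterm, ← mul_sum] at h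
  have hne : ∀ i : ℕ, 1 + (-(M : ℂ) - 1 / 3) + i ≠ 0 := fun i hi => by
    have : ((3 * i + 2 : ℤ) - 3 * M : ℤ) ≠ 0 := by omega
    refine this ?_
    have : (((3 * i + 2 : ℤ) - 3 * M : ℤ) : ℂ) = 0 := by push_cast; linear_combination 3 * hi
    exact_mod_cast this
  have hwp := sum_wellPoised M (-(M : ℂ) - 1 / 3) hne
  have hb : ∀ i : ℕ, (2 : ℂ) / 3 + i ≠ 0 := fun i hi => by
    have := hne (M + i)
    push_cast at this
    exact this (by linear_combination hi)
  have hs : ∀ j, ∏ i ∈ range (M + j), (1 + (-(M : ℂ) - 1 / 3) + i) =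
      (∏ i ∈ range M, ((2 : ℂ) / 3 - M + i)) * ∏ i ∈ range j, ((2 : ℂ) / 3 + i) := by
    intro j
    rw [prod_range_add]
    congr 1 <;> refine prod_congr rfl fun i _ => ?_ <;> push_cast <;> ring
  have hs₀ : ∏ i ∈ range M, ((2 : ℂ) / 3 - M + i) ≠ 0 :=
    prod_ne_zero_iff.2 fun i _ => by
      have := hne i
      rwa [show (2 : ℂ) / 3 - M + i = 1 + (-(M : ℂ) - 1 / 3) + i by ring]
  have hodd : ∏ i ∈ range M, (1 + (-(M : ℂ) - 1 / 3) + 2 * i) =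
      ∏ i ∈ range M, ((2 : ℂ) / 3 - M + 2 * i) := prod_congr rfl fun i _ => by ring
  rw [hodd] at hwp
  set K : ℂ := 3 ^ M * M.factorial * ∏ i ∈ range (M + 1), (3 * (i : ℂ) + 1)
  have hsum : (∑ j ∈ range (M + 1), ((X - C 1) ^ (2 * M + 1) * ((X + C 1) * p)).coeff (3 * j) *
        ((-1) ^ j * (-(M : ℂ) - 1 / 3 + 2 * j))) * K =
      -((2 * M + 1).factorial * (2 * p.eval 1)) * (∏ i ∈ range M, ((2 : ℂ) / 3 - M + i)) *
      ∑ j ∈ range (M + 1), (M.choose j : ℂ) * (-(M : ℂ) - 1 / 3 + 2 * j) *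
        ((∏ i ∈ range j, (-(M : ℂ) - 1 / 3 + i)) /
          ∏ i ∈ range (M + j), (1 + (-(M : ℂ) - 1 / 3) + i)) := by
    rw [sum_mul, mul_sum]
    refine sum_congr rfl fun j hj => ?_
    have hc := coeff_three_mul hsupp (mem_range_succ_iff.1 hj)
    have hbj : ∏ i ∈ range j, ((2 : ℂ) / 3 + i) ≠ 0 := prod_ne_zero_iff.2 fun i _ => hb i
    have hsign : ((-1 : ℂ) ^ j) * (-1) ^ j = 1 := by rw [← mul_pow]; simp
    rw [hs, mul_comm (∏ i ∈ range M, ((2 : ℂ) / 3 - M + i)), ← div_div,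
      mul_right_comm, hc]
    simp only [eval_mul, eval_add, eval_X, eval_C]
    set A := (∏ i ∈ range j, (-(M : ℂ) - 1 / 3 + i)) / ∏ i ∈ range j, ((2 : ℂ) / 3 + i)
    have hA : (∏ i ∈ range M, ((2 : ℂ) / 3 - M + i)) *
        (A / ∏ i ∈ range M, ((2 : ℂ) / 3 - M + i)) = A := mul_div_cancel₀ _ hs₀
    linear_combination -((2 * M + 1).factorial * (2 * p.eval 1)) * (M.choose j : ℂ) *
      (-(M : ℂ) - 1 / 3 + 2 * j) * (A * hsign - hA)
  have h2 : (2 : ℂ) ^ M ≠ 0 := pow_ne_zero _ two_ne_zero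
  refine mul_left_cancel₀ h2 ?_
  linear_combination -(K * ∏ i ∈ range M, ((2 : ℂ) / 3 - M + 2 * i)) * h +
    3 * (∏ i ∈ range M, ((2 : ℂ) / 3 - M + 2 * i)) * hsum -
    3 * ((2 * M + 1).factorial * (2 * p.eval 1)) *
      (∏ i ∈ range M, ((2 : ℂ) / 3 - M + i)) * hwp

end SpecialValueRatios

section HomogeneousValues

variable {w : ℂ}

lemma prod_range_add_one_add (M : ℕ) :
    (∏ i ∈ range M, ((M : ℂ) + 1 + i)) * M.factorial = (2 * M).factorial := by
  rw [← prod_range_add_one_eq_factorial, ← prod_range_add_one_eq_factorial, two_mul,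
    prod_range_add, mul_comm]
  push_cast
  exact congrArg _ (prod_congr rfl fun i _ => by ring)

lemma factorial_three_mul_add_one (M : ℕ) :
    3 ^ M * M.factorial * (∏ i ∈ range (M + 1), (3 * (i : ℂ) + 1)) *
      (3 ^ M * ∏ i ∈ range M, ((2 : ℂ) / 3 + i)) = (3 * M + 1).factorial := by
  induction M with
  | zero => simp
  | succ M ih =>
    rw [prod_range_succ _ (M + 1), prod_range_succ (fun i : ℕ => (2 : ℂ) / 3 + i) M,
      Nat.factorial_succ M,
      show 3 * (M + 1) + 1 = 3 * M + 1 + 1 + 1 + 1 by ring, Nat.factorial_succ (3 * M + 1 + 1 + 1),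
      Nat.factorial_succ (3 * M + 1 + 1), Nat.factorial_succ (3 * M + 1)]
    push_cast
    rw [← ih]
    ring

lemma prod_two_thirds_sub (M : ℕ) :
    3 ^ M * ∏ i ∈ range M, ((2 : ℂ) / 3 - M + i) =
      (-1) ^ M * ∏ i ∈ range M, (3 * (i : ℂ) + 1) := by
  rw [← prod_range_reflect (fun i : ℕ => 3 * (i : ℂ) + 1)]
  have h (c : ℂ) : c ^ M = ∏ _i ∈ range M, c := by rw [prod_const, card_range]
  rw [h, h, ← prod_mul_distrib, ← prod_mul_distrib]
  refine prod_congr rfl fun i hi => ?_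
  rw [mem_range] at hi
  rw [show M - 1 - i = M - (i + 1) by omega, Nat.cast_sub (by omega)]
  push_cast
  ring

lemma prod_two_thirds_sub_two_mul (k : ℕ) :
    3 ^ (2 * k + 1) * ∏ i ∈ range (2 * k + 1), ((2 : ℂ) / 3 - (2 * k + 1 : ℕ) + 2 * i) =
      (-1) ^ (k + 1) *
        ((∏ i ∈ range (k + 1), (6 * (i : ℂ) + 1)) * ∏ i ∈ range k, (6 * (i : ℂ) + 5)) := by
  have h (c : ℂ) (N : ℕ) : c ^ N = ∏ _i ∈ range N, c := by rw [prod_const, card_range]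
  rw [← prod_range_reflect (fun i : ℕ => 6 * (i : ℂ) + 1), show 2 * k + 1 = k + 1 + k by ring,
    pow_add 3, prod_range_add, mul_mul_mul_comm]
  refine (congrArg₂ (· * ·) ?_ ?_).trans (mul_assoc _ _ _)
  · rw [h, h, ← prod_mul_distrib, ← prod_mul_distrib]
    refine prod_congr rfl fun i hi => ?_
    rw [mem_range] at hi
    rw [Nat.add_sub_cancel, Nat.cast_sub (by omega)]
    push_cast
    ring
  · rw [h, ← prod_mul_distrib]
    refine prod_congr rfl fun i hi => ?_
    push_cast
    ring

lemma exists_eval_homogeneous (hw : w ^ 2 + w + 1 = 0) (M : ℕ) :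
    ∃ p : Polynomial ℂ,
      (∀ x, partitionFn w (x :: List.replicate M 1) (List.replicate (M + 1) false) = p.eval x) ∧
      ((Polynomial.X - Polynomial.C 1) ^ (2 * M + 1) *
        ((Polynomial.X + Polynomial.C 1) * p)).degree < 3 * (M : WithBot ℕ) + 2 ∧
      ∀ e ∉ exponentSet M, ((Polynomial.X - Polynomial.C 1) ^ (2 * M + 1) *
        ((Polynomial.X + Polynomial.C 1) * p)).coeff e = 0 := by
  obtain ⟨p, hp, hdeg, hcoeff⟩ := exists_homogeneous_polynomial hw M
  refine ⟨p, hp, hdeg, fun e he => ?_⟩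
  by_cases h : e < 3 * M + 2
  · obtain ⟨i, rfl⟩ : ∃ i, e = 3 * i + 2 := ⟨e / 3, by
      have : ¬ (e % 3 ≠ 2) := fun h' => he (mem_exponentSet.2 ⟨h, h'⟩)
      omega⟩
    exact hcoeff i
  · refine Polynomial.coeff_eq_zero_of_degree_lt (hdeg.trans_le ?_)
    exact_mod_cast not_lt.1 h

/-- Ratio of consecutive homogeneous partition functions. -/
lemma partitionFn_replicate_one_succ (hw : w ^ 2 + w + 1 = 0) (k : ℕ) :
    partitionFn w (List.replicate (2 * (k + 1)) 1) (List.replicate (2 * (k + 1)) false) *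
        (2 * (4 * k + 3).factorial * (4 * k + 2).factorial) =
      partitionFn w (List.replicate (2 * k) 1) (List.replicate (2 * k) false) *
        ((2 * k + 1).factorial * (6 * k + 4).factorial) := by
  obtain ⟨p, hp, hdeg, hsupp⟩ := exists_eval_homogeneous hw (2 * k + 1)
  have h := eval_sq_mul hw hdeg hsupp
  have hw3 : w ^ 3 = 1 := by linear_combination (w - 1) * hw
  have hz₁ : p.eval 1 =
      partitionFn w (List.replicate (2 * (k + 1)) 1) (List.replicate (2 * (k + 1)) false) := by
    rw [← hp]
    rfl
  have hz₂ : p.eval (w ^ 2) = w ^ (2 * k) *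
      partitionFn w (List.replicate (2 * k) 1) (List.replicate (2 * k) false) := by
    have := partitionFn_of_mul_eq_inv (w := w) (w ^ 2) 1 (by linear_combination hw3)
      (List.replicate (2 * k) 1)
    rw [← hp, List.replicate_succ]
    rw [List.length_replicate] at this
    rw [this]
    simp only [List.map_replicate, List.prod_replicate]
    rw [show (w ^ 2 - 1) / 3 * (w - w ^ 2 * 1) = -w by linear_combination (-(w ^ 2) + 2 * w) / 3 * hw,
      show (w ^ 2 - 1) / 3 * (w - 1 * 1) = 1 by linear_combination (w - 2) / 3 * hw, one_pow, mul_one,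
      Even.neg_pow (even_two_mul k)]
  have hne : w ^ 2 - 1 ≠ 0 := fun h0 => by
    have h1 : (3 : ℂ) = 0 := by linear_combination (2 - w) * hw + (w - 1) * h0
    norm_num at h1
  have hphase : (w ^ 2 - 1) ^ (2 * (2 * k + 1)) * (w ^ 2 + 1) * w ^ (2 * k) = 3 ^ (2 * k + 1) := by
    rw [pow_mul, show (w ^ 2 - 1) ^ 2 = -(3 * w ^ 2) by linear_combination (w ^ 2 - w + 1) * hw,
      Odd.neg_pow ⟨k, rfl⟩, show w ^ 2 + 1 = -w by linear_combination hw, mul_pow]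
    calc _ = 3 ^ (2 * k + 1) * (w ^ 3) ^ (2 * k + 1) := by ring
      _ = _ := by rw [hw3, one_pow, mul_one]
  rw [hz₁, hz₂] at h
  have hB : ∏ i ∈ range (2 * k + 1), ((2 : ℂ) / 3 + i) ≠ 0 := by
    refine prod_ne_zero_iff.2 fun i _ => ?_
    have : ((3 * i + 2 : ℕ) : ℂ) ≠ 0 := Nat.cast_ne_zero.2 (by omega)
    intro h
    exact this (by push_cast; linear_combination 3 * h)
  rw [mul_div_assoc', eq_div_iff hB] at h
  have hf₁ := prod_range_add_one_add (2 * k + 1)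
  have hf₂ := factorial_three_mul_add_one (2 * k + 1)
  rw [show 2 * (2 * k + 1) = 4 * k + 2 by ring] at h hf₁ hphase
  rw [show 3 * (2 * k + 1) + 1 = 6 * k + 4 by ring] at hf₂
  rw [← hf₁, ← hf₂]
  refine mul_left_cancel₀ hne ?_
  rw [show 4 * k + 2 + 1 = 4 * k + 3 by ring] at h
  linear_combination -((2 * k + 1).factorial : ℂ) * h + (w ^ 2 - 1) *
    partitionFn w (List.replicate (2 * k) 1) (List.replicate (2 * k) false) *
    (2 * k + 1).factorial * (3 ^ (2 * k + 1) * (2 * k + 1).factorial *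
      (∏ i ∈ range (2 * k + 1 + 1), (3 * (i : ℂ) + 1)) *
      ∏ i ∈ range (2 * k + 1), ((2 : ℂ) / 3 + i)) * hphase

lemma partitionFn_neg_one (hw : w ^ 2 + w + 1 = 0) (k : ℕ) :
    partitionFn w (-1 :: List.replicate (2 * k + 1) 1) (List.replicate (2 * (k + 1)) false) *
        ((-1) ^ k * 6 ^ (2 * k + 1) * (2 * k + 1).factorial *
          ((∏ i ∈ range (k + 1), (6 * (i : ℂ) + 1)) * ∏ i ∈ range k, (6 * (i : ℂ) + 5))) =
      partitionFn w (List.replicate (2 * (k + 1)) 1) (List.replicate (2 * (k + 1)) false) *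
        (4 * k + 3).factorial := by
  obtain ⟨p, hp, hdeg, hsupp⟩ := exists_eval_homogeneous hw (2 * k + 1)
  have h := eval_neg_one_mul hdeg hsupp ⟨k, rfl⟩
  have hz₁ : p.eval 1 =
      partitionFn w (List.replicate (2 * (k + 1)) 1) (List.replicate (2 * (k + 1)) false) := by
    rw [← hp]
    rfl
  have hz₂ : partitionFn w (-1 :: List.replicate (2 * k + 1) 1)
      (List.replicate (2 * (k + 1)) false) = p.eval (-1) := hp _
  rw [← hz₁, hz₂]
  have hA := prod_two_thirds_sub (2 * k + 1)
  have hO := prod_two_thirds_sub_two_mul k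
  rw [prod_range_succ _ (2 * k + 1)] at h
  have hT : ∏ i ∈ range (2 * k + 1), (3 * (i : ℂ) + 1) ≠ 0 :=
    prod_ne_zero_iff.2 fun i _ => by exact_mod_cast Nat.succ_ne_zero (3 * i)
  have hl : 3 * ((2 * k + 1 : ℕ) : ℂ) + 1 ≠ 0 := by
    exact_mod_cast Nat.succ_ne_zero (3 * (2 * k + 1))
  have h2 : (2 : ℂ) ≠ 0 := two_ne_zero
  rw [Odd.neg_one_pow ⟨k, rfl⟩] at hA
  refine mul_left_cancel₀ (mul_ne_zero h2 (mul_ne_zero hT hl)) ?_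
  rw [show (6 : ℂ) ^ (2 * k + 1) = 2 ^ (2 * k + 1) * 3 ^ (2 * k + 1) by rw [← mul_pow]; norm_num]
  rw [show 2 * (2 * k + 1) + 1 = 4 * k + 3 by ring] at h
  set T := ∏ i ∈ range (2 * k + 1), (3 * (i : ℂ) + 1)
  set D := (∏ i ∈ range (k + 1), (6 * (i : ℂ) + 1)) * ∏ i ∈ range k, (6 * (i : ℂ) + 5)
  linear_combination -(3 : ℂ) ^ (2 * k + 1) * h -
    ((4 * k + 3).factorial * (2 * p.eval 1)) * (3 * ((2 * k + 1 : ℕ) : ℂ) + 1) * hA +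
    2 ^ (2 * k + 1 + 1) * p.eval (-1) * (3 ^ (2 * k + 1) * (2 * k + 1).factorial *
      (T * (3 * ((2 * k + 1 : ℕ) : ℂ) + 1))) * hO

end HomogeneousValues

section Enumeration

/-- The partial sums of `a`, started from `b`, take values in `{0, 1}` and end at `1`. -/
def AlternatesFrom {m : ℕ} (b : ℤ) (a : Fin m → ℤ) : Prop :=
  (∀ k : Fin m, b + ∑ j ∈ univ.filter (fun j => j ≤ k), a j = 0 ∨
    b + ∑ j ∈ univ.filter (fun j => j ≤ k), a j = 1) ∧ b + ∑ j, a j = 1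

lemma alternatesFrom_succ {m : ℕ} (b : ℤ) (a : Fin (m + 1) → ℤ) :
    AlternatesFrom b a ↔ (b + a 0 = 0 ∨ b + a 0 = 1) ∧
      AlternatesFrom (b + a 0) (fun j => a j.succ) := by
  simp only [AlternatesFrom, Fin.forall_fin_succ, sum_filter, Fin.sum_univ_succ,
    Fin.succ_le_succ_iff, Fin.zero_le, if_true, add_assoc]
  simp [and_assoc]

/-- Symmetric integer matrices with zero diagonal whose rows alternate when started from `v`. -/
def symmAlternating {m : ℕ} (v : Fin m → Bool) : Set (Matrix (Fin m) (Fin m) ℤ) :=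
  {A | A.IsSymm ∧ (∀ i, A i i = 0) ∧ ∀ i, AlternatesFrom ((v i).toNat : ℤ) (A i)}

/-- The symmetric matrix with zero diagonal entry whose first row changes the states `v` to `v'`
and whose remaining block is `A`. -/
def borderMatrix {m : ℕ} (v v' : Fin m → Bool) (A : Matrix (Fin m) (Fin m) ℤ) :
    Matrix (Fin (m + 1)) (Fin (m + 1)) ℤ :=
  Matrix.of (Fin.cons (Fin.cons 0 fun j => ((v' j).toNat : ℤ) - (v j).toNat)
    fun i => Fin.cons (((v' i).toNat : ℤ) - (v i).toNat) (A i))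

section Border

variable {m : ℕ} (v v' : Fin m → Bool) (A : Matrix (Fin m) (Fin m) ℤ)

@[simp] lemma borderMatrix_zero_zero : borderMatrix v v' A 0 0 = 0 := rfl

@[simp] lemma borderMatrix_zero_succ (j : Fin m) :
    borderMatrix v v' A 0 j.succ = ((v' j).toNat : ℤ) - (v j).toNat := rfl

@[simp] lemma borderMatrix_succ_zero (i : Fin m) :
    borderMatrix v v' A i.succ 0 = ((v' i).toNat : ℤ) - (v i).toNat := rfl

@[simp] lemma borderMatrix_succ_succ (i j : Fin m) :
    borderMatrix v v' A i.succ j.succ = A i j := rfl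

end Border

lemma toNat_eq_zero_or_one (b : Bool) : (b.toNat : ℤ) = 0 ∨ (b.toNat : ℤ) = 1 := by
  cases b <;> simp

lemma borderMatrix_mem {m : ℕ} (v : Fin (m + 1) → Bool) (v' : Fin m → Bool)
    (A : Matrix (Fin m) (Fin m) ℤ) :
    borderMatrix (Fin.tail v) v' A ∈ symmAlternating v ↔
      AlternatesFrom ((v 0).toNat : ℤ)
        (fun j => ((v' j).toNat : ℤ) - (v j.succ).toNat) ∧ A ∈ symmAlternating v' := by
  simp only [symmAlternating, Set.mem_ofPred_eq, Matrix.IsSymm.ext_iff, Fin.forall_fin_succ,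
    alternatesFrom_succ, borderMatrix_zero_zero, borderMatrix_zero_succ, borderMatrix_succ_zero,
    borderMatrix_succ_succ, Fin.tail, add_zero, add_sub_cancel, toNat_eq_zero_or_one, true_and,
    implies_true]
  tauto

lemma symmAlternating_succ {m : ℕ} (v : Fin (m + 1) → Bool) :
    symmAlternating v = ⋃ v' ∈ {v' : Fin m → Bool | AlternatesFrom ((v 0).toNat : ℤ)
        (fun j => ((v' j).toNat : ℤ) - (v j.succ).toNat)},
      Set.image (borderMatrix (Fin.tail v) v') (symmAlternating v') := by
  ext A
  simp only [Set.mem_iUnion, Set.mem_image, Set.mem_ofPred_eq, exists_prop]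
  constructor
  · intro hA
    have key : ∀ j : Fin m, ∃ b : Bool, (b.toNat : ℤ) = (v j.succ).toNat + A 0 j.succ := by
      intro j
      have h := ((alternatesFrom_succ _ _).1 (hA.2.2 j.succ)).1
      rw [← hA.1.apply]
      rcases h with h | h
      · exact ⟨false, by simpa using h.symm⟩
      · exact ⟨true, by simpa using h.symm⟩
    choose v' hv' using key
    have hb : borderMatrix (Fin.tail v) v' (A.submatrix Fin.succ Fin.succ) = A := by
      ext i j
      refine Fin.cases ?_ (fun i => ?_) i <;> refine Fin.cases ?_ (fun j => ?_) j
      · simp [hA.2.1]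
      · simp [hv', Fin.tail]
      · simp [hv', Fin.tail, hA.1.apply]
      · simp
    rw [← hb, borderMatrix_mem] at hA
    exact ⟨v', hA.1, _, hA.2, hb⟩
  · rintro ⟨v', h, A, hA, rfl⟩
    exact (borderMatrix_mem v v' A).2 ⟨h, hA⟩

lemma finite_symmAlternating {m : ℕ} (v : Fin m → Bool) : (symmAlternating v).Finite := by
  induction m with
  | zero => exact Set.toFinite _
  | succ m ih =>
    rw [symmAlternating_succ]
    exact (Set.toFinite _).biUnion fun v' _ => (ih v').image _

open Classical in
lemma finsum_symmAlternating_succ {R : Type*} [AddCommMonoid R] {m : ℕ} (v : Fin (m + 1) → Bool)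
    (φ : Matrix (Fin (m + 1)) (Fin (m + 1)) ℤ → R) :
    ∑ᶠ A ∈ symmAlternating v, φ A =
      ∑ v' : Fin m → Bool, if AlternatesFrom ((v 0).toNat : ℤ)
          (fun j => ((v' j).toNat : ℤ) - (v j.succ).toNat) then
        ∑ᶠ A ∈ symmAlternating v', φ (borderMatrix (Fin.tail v) v' A) else 0 := by
  have hinj : ∀ (v' u' : Fin m → Bool) (A B : Matrix (Fin m) (Fin m) ℤ),
      borderMatrix (Fin.tail v) v' A = borderMatrix (Fin.tail v) u' B → v' = u' ∧ A = B := by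
    intro v' u' A B h
    refine ⟨funext fun j => ?_, Matrix.ext fun i j => ?_⟩
    · have := congrFun (congrFun h 0) j.succ
      simp only [borderMatrix_zero_succ, sub_left_inj, Nat.cast_inj] at this
      revert this
      cases v' j <;> cases u' j <;> simp
    · exact congrFun (congrFun h i.succ) j.succ
  rw [symmAlternating_succ, finsum_mem_biUnion _ (Set.toFinite _)
    fun v' _ => (finite_symmAlternating v').image _, finsum_eq_sum_of_fintype]
  · refine sum_congr rfl fun v' _ => ?_
    rw [finsum_eq_if, finsum_mem_image fun A _ B _ h => (hinj _ _ _ _ h).2]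
    rfl
  · rintro v' - u' - hne
    refine Set.disjoint_left.2 ?_
    rintro _ ⟨A, -, rfl⟩ ⟨B, -, h⟩
    exact hne (hinj _ _ _ _ h).1.symm

end Enumeration

section Bridge

variable {w : ℂ}

lemma vertexWeight_one (hw : w ^ 2 + w + 1 = 0) (h v h' v' : Bool) :
    vertexWeight w 1 h v h' v' =
      if (h'.toNat : ℤ) = h.toNat + (v'.toNat - v.toNat) then 1 else 0 := by
  cases h <;> cases v <;> cases h' <;> cases v' <;> simp [vertexWeight] <;> grind

open Classical in
lemma rowTransfer_one (hw : w ^ 2 + w + 1 = 0) {m : ℕ} (h : Bool) (v : Fin m → Bool)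
    (k : List Bool → ℂ) :
    rowTransfer w 1 h (List.replicate m 1) (List.ofFn v) k =
      ∑ v' : Fin m → Bool, if AlternatesFrom (h.toNat : ℤ)
        (fun j => ((v' j).toNat : ℤ) - (v j).toNat) then k (List.ofFn v') else 0 := by
  induction m generalizing h k with
  | zero => cases h <;> simp [rowTransfer, AlternatesFrom]
  | succ m ih =>
    rw [List.replicate_succ, List.ofFn_succ, rowTransfer,
      ← Equiv.sum_comp (Fin.consEquiv fun _ : Fin (m + 1) => Bool), Fintype.sum_prod_type,
      sum_comm]
    refine sum_congr rfl fun b _ => ?_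
    simp only [ih, mul_one, vertexWeight_one hw, alternatesFrom_succ, Fin.consEquiv_apply,
      Fin.cons_zero, Fin.cons_succ, List.ofFn_succ, mul_sum]
    rw [sum_comm]
    refine sum_congr rfl fun v' _ => ?_
    generalize (h.toNat : ℤ) + (b.toNat - (v 0).toNat) = c
    by_cases h0 : c = 0
    · simp [h0]
    by_cases h1 : c = 1
    · simp [h1]
    · simp [h0, h1, eq_comm]

lemma partitionFn_one (hw : w ^ 2 + w + 1 = 0) {m : ℕ} (v : Fin m → Bool) :
    partitionFn w (List.replicate m 1) (List.ofFn v) = ∑ᶠ A ∈ symmAlternating v, 1 := by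
  classical
  induction m with
  | zero =>
    have : symmAlternating v = {0} := by
      ext A
      simp [symmAlternating, Matrix.IsSymm.ext_iff, Subsingleton.elim A 0]
    rw [this, finsum_mem_singleton]
    simp [partitionFn]
  | succ m ih =>
    rw [List.replicate_succ, List.ofFn_succ, partitionFn, rowTransfer_one hw,
      finsum_symmAlternating_succ]
    simp only [ih]

lemma entry_of_alternatesFrom {m : ℕ} {b : ℤ} {a : Fin m → ℤ} (ha : AlternatesFrom b a)
    (hb : b = 0 ∨ b = 1) (j : Fin m) : a j = -1 ∨ a j = 0 ∨ a j = 1 := by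
  induction m generalizing b with
  | zero => exact j.elim0
  | succ m ih =>
    rw [alternatesFrom_succ] at ha
    refine Fin.cases ?_ (fun j => ?_) j
    · omega
    · exact ih ha.2 ha.1 j

lemma rowTransfer_neg_one (m : ℕ) (k : List Bool → ℂ) (hw : w ^ 2 + w + 1 = 0) :
    (w ^ 2 - 1) / 3 * (w + 1) *
        rowTransfer w (-1) false (List.replicate m 1) (List.replicate m false) k =
      ((w ^ 2 - 1) / 3 * (w + 1)) ^ m *
        rowTransfer w 1 false (List.replicate m 1) (List.replicate m false)
          (fun l => (-1) ^ l.idxOf true * k l) := by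
  induction m generalizing k with
  | zero => simp [rowTransfer]
  | succ m ih =>
    have h₁ := rowTransfer_false_cons_replicate (w := w) 1 1 (List.replicate m 1)
    have h₂ := rowTransfer_false_cons_replicate (w := w) (-1) 1 (List.replicate m 1)
    have hα : (w ^ 2 - 1) / 3 * (w - 1) = 1 := by grind
    simp only [List.length_replicate, List.map_replicate, List.prod_replicate, mul_one] at h₁ h₂
    rw [List.replicate_succ (a := (1 : ℂ)), h₁, h₂, hα]
    have hs : (fun l : List Bool => (-1 : ℂ) ^ (false :: l).idxOf true * k (false :: l)) =
        fun l => -1 * ((-1) ^ l.idxOf true * k (false :: l)) := by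
      ext l
      rw [List.idxOf_cons_ne _ (by simp), pow_succ]
      ring
    rw [hs, rowTransfer_mul, List.idxOf_cons_self]
    linear_combination -((w ^ 2 - 1) / 3 * (w + 1)) * ih fun l => k (false :: l)

lemma isOSASMeven_iff_s11 {m : ℕ} (A : Matrix (Fin m) (Fin m) ℤ) :
    IsOSASMeven A ↔ A ∈ symmAlternating fun _ => false := by
  simp only [IsOSASMeven, IsDSASM, IsASM, symmAlternating, Set.mem_ofPred_eq, AlternatesFrom,
    Bool.toNat_false, Nat.cast_zero, zero_add]
  constructor
  · rintro ⟨⟨⟨-, h₁, -, h₂, -⟩, h₃⟩, h₄⟩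
    exact ⟨h₃, h₄, fun i => ⟨h₁ i, h₂ i⟩⟩
  · rintro ⟨h₁, h₂, h₃⟩
    refine ⟨⟨⟨fun i => ?_, fun i => (h₃ i).1, fun i => ?_, fun i => (h₃ i).2, fun i => ?_⟩, h₁⟩, h₂⟩
    · exact entry_of_alternatesFrom (b := 0) (by simpa [AlternatesFrom] using h₃ i) (by simp)
    · simpa only [h₁.apply] using (h₃ i).1
    · simpa only [h₁.apply] using (h₃ i).2

lemma sum_add_mul_toNat {m : ℕ} (v : Fin m → Bool) (hv : ∑ j, (v j).toNat = 1) (c : ℕ) :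
    ∑ j : Fin m, ((j : ℕ) + c) * (v j).toNat = (List.ofFn v).idxOf true + c := by
  induction m generalizing c with
  | zero => simp at hv
  | succ m ih =>
    rw [Fin.sum_univ_succ] at hv ⊢
    rw [List.ofFn_succ]
    cases h : v 0
    · rw [h] at hv
      have := ih (fun j => v j.succ) (by simpa using hv) (c + 1)
      rw [List.idxOf_cons_ne _ (by simp)]
      simp only [Fin.val_succ, Bool.toNat_false, mul_zero, zero_add]
      simp only [add_assoc, add_comm 1 c]
      rw [this]
      omega
    · rw [h] at hv
      have : ∀ j : Fin m, (v j.succ).toNat = 0 := by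
        simpa using hv
      simp [this]

lemma Tstat_borderMatrix {m : ℕ} (v' : Fin m → Bool) (A : Matrix (Fin m) (Fin m) ℤ)
    (hv : AlternatesFrom 0 fun j => ((v' j).toNat : ℤ)) :
    Tstat (borderMatrix (fun _ => false) v' A) = (List.ofFn v').idxOf true + 2 := by
  have hv' : ∑ j, (v' j).toNat = 1 := by
    have := (zero_add _).symm.trans hv.2
    beta_reduce at this
    exact_mod_cast this
  rw [← sum_add_mul_toNat v' hv', Tstat, sum_filter, Fintype.sum_prod_type, Fin.sum_univ_succ]
  simp [Fin.sum_univ_succ, add_assoc]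

lemma finsum_OSASMeven (hw : w ^ 2 + w + 1 = 0) (m : ℕ) :
    ((∑ᶠ A ∈ {A : Matrix (Fin (m + 1)) (Fin (m + 1)) ℤ | IsOSASMeven A},
      ((-1 : ℚ)) ^ Tstat A : ℚ) : ℂ) =
      rowTransfer w 1 false (List.replicate m 1) (List.replicate m false)
        (fun l => (-1) ^ l.idxOf true * partitionFn w (List.replicate m 1) l) := by
  classical
  have hset : {A : Matrix (Fin (m + 1)) (Fin (m + 1)) ℤ | IsOSASMeven A} =
      symmAlternating fun _ => false := Set.ext isOSASMeven_iff_s11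
  rw [hset, finsum_symmAlternating_succ, ← List.ofFn_const m false, rowTransfer_one hw]
  simp only [Bool.toNat_false, Nat.cast_zero, sub_zero]
  rw [Rat.cast_sum]
  refine sum_congr rfl fun v' _ => ?_
  split_ifs with h
  · have hF := finite_symmAlternating v'
    rw [partitionFn_one hw, finsum_mem_eq_finite_toFinset_sum _ hF,
      finsum_mem_eq_finite_toFinset_sum _ hF, Rat.cast_sum, mul_sum]
    refine sum_congr rfl fun A _ => ?_
    have := Tstat_borderMatrix v' A h
    rw [show Fin.tail (fun _ : Fin (m + 1) => false) = fun _ => false from rfl, this]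
    push_cast
    ring
  · simp

lemma partitionFn_neg_one_eq_finsum (hw : w ^ 2 + w + 1 = 0) (k : ℕ) :
    partitionFn w (-1 :: List.replicate (2 * k + 1) 1) (List.replicate (2 * (k + 1)) false) =
      (-1 / 3) ^ k * ((∑ᶠ A ∈ {A : Matrix (Fin (2 * (k + 1))) (Fin (2 * (k + 1))) ℤ |
        IsOSASMeven A}, ((-1 : ℚ)) ^ Tstat A : ℚ) : ℂ) := by
  have hne : (w ^ 2 - 1) / 3 * (w + 1) ≠ 0 := by
    intro h
    grind
  have hsq : ((w ^ 2 - 1) / 3 * (w + 1)) ^ 2 = -1 / 3 := by grind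
  refine mul_left_cancel₀ hne ?_
  refine (rowTransfer_neg_one (2 * k + 1) _ hw).trans ?_
  rw [← finsum_OSASMeven hw (2 * k + 1), pow_succ, pow_mul, hsq, mul_comm _ ((w ^ 2 - 1) / 3 * _),
    mul_assoc]
  rfl

end Bridge

section ClosedForm

lemma prod_factorial_succ (k : ℕ) :
    (∏ i ∈ range (k + 1), ((2 * (k + 1) + 2 * i + 3).factorial : ℂ)) * (2 * k + 3).factorial =
      (∏ i ∈ range k, ((2 * k + 2 * i + 3).factorial : ℂ)) * (4 * k + 3).factorial *
        (4 * k + 5).factorial := by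
  have h := prod_range_succ' (fun i => ((2 * k + 2 * i + 3).factorial : ℂ)) (k + 1)
  rw [prod_range_succ, prod_range_succ] at h
  rw [show 2 * k + 2 * k + 3 = 4 * k + 3 by ring,
    show 2 * k + 2 * (k + 1) + 3 = 4 * k + 5 by ring] at h
  rw [h]
  congr 1
  exact prod_congr rfl fun i _ => by congr 2; ring

lemma closedForm_mul {w : ℂ} (hw : w ^ 2 + w + 1 = 0) (k : ℕ) :
    ((3 * k + 2).factorial : ℂ) * (∏ i ∈ range k, ((6 * i + 4).factorial : ℂ)) *
        6 ^ (2 * k + 1) *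
        ((∏ i ∈ range (k + 1), (6 * (i : ℂ) + 1)) * ∏ i ∈ range k, (6 * (i : ℂ) + 5)) =
      3 ^ k * partitionFn w (List.replicate (2 * (k + 1)) 1) (List.replicate (2 * (k + 1)) false) *
        (4 * k + 3).factorial * 2 ^ (k + 1) *
        ∏ i ∈ range k, ((2 * k + 2 * i + 3).factorial : ℂ) := by
  induction k with
  | zero =>
    have h := partitionFn_replicate_one_succ hw 0
    rw [show partitionFn w (List.replicate (2 * 0) 1) (List.replicate (2 * 0) false) = 1 from rfl]
      at h
    simp [Nat.factorial] at h ⊢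
    linear_combination -(1 / 2) * h
  | succ k ih =>
    have hz := partitionFn_replicate_one_succ hw (k + 1)
    have hp := prod_factorial_succ k
    generalize partitionFn w (List.replicate (2 * (k + 1 + 1)) 1)
      (List.replicate (2 * (k + 1 + 1)) false) = z' at *
    generalize partitionFn w (List.replicate (2 * (k + 1)) 1)
      (List.replicate (2 * (k + 1)) false) = z at *
    rw [prod_range_succ _ k, prod_range_succ _ (k + 1),
      prod_range_succ (fun i : ℕ => 6 * (i : ℂ) + 5) k]
    generalize (∏ i ∈ range (k + 1), ((2 * (k + 1) + 2 * i + 3).factorial : ℂ)) = P' at *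
    generalize (∏ i ∈ range k, ((2 * k + 2 * i + 3).factorial : ℂ)) = P at *
    rw [show 3 * (k + 1) + 2 = 3 * k + 2 + 1 + 1 + 1 by ring, Nat.factorial_succ,
      Nat.factorial_succ, Nat.factorial_succ]
    rw [show 4 * (k + 1) + 3 = 4 * k + 7 by ring, show 4 * (k + 1) + 2 = 4 * k + 5 + 1 by ring,
      show 2 * (k + 1) + 1 = 2 * k + 3 by ring,
      show 6 * (k + 1) + 4 = 6 * k + 4 + 1 + 1 + 1 + 1 + 1 + 1 by ring] at hz
    rw [show 4 * (k + 1) + 3 = 4 * k + 7 by ring]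
    simp only [Nat.factorial_succ (6 * k + 4), Nat.factorial_succ (6 * k + 4 + 1),
      Nat.factorial_succ (6 * k + 4 + 1 + 1), Nat.factorial_succ (6 * k + 4 + 1 + 1 + 1),
      Nat.factorial_succ (6 * k + 4 + 1 + 1 + 1 + 1),
      Nat.factorial_succ (6 * k + 4 + 1 + 1 + 1 + 1 + 1), Nat.factorial_succ (4 * k + 5)] at hz
    push_cast at *
    have h₁ : ((4 * k + 5).factorial : ℂ) ≠ 0 := Nat.cast_ne_zero.2 (Nat.factorial_ne_zero _)
    have h₂ : ((2 * k + 3).factorial : ℂ) ≠ 0 := Nat.cast_ne_zero.2 (Nat.factorial_ne_zero _)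
    have h₃ : (4 * (k : ℂ) + 5 + 1) ≠ 0 := by exact_mod_cast Nat.succ_ne_zero (4 * k + 5)
    refine mul_right_cancel₀ (mul_ne_zero h₃ (mul_ne_zero h₁ h₂)) ?_
    linear_combination
      (3 * k + 2 + 1 + 1 + 1) * (3 * k + 2 + 1 + 1) * (3 * k + 2 + 1) * (6 * k + 4).factorial * 36 *
        (6 * k + 7) * (6 * k + 5) * (4 * k + 5 + 1) * (4 * k + 5).factorial *
        (2 * k + 3).factorial * ih -
      3 ^ (k + 1) * 2 ^ (k + 1) * P' * (2 * k + 3).factorial * hz -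
      3 ^ (k + 1) * 2 ^ (k + 1) * z * (2 * k + 3).factorial * ((6 * k + 4 + 1 + 1 + 1 + 1 + 1 + 1) *
        (6 * k + 4 + 1 + 1 + 1 + 1 + 1) * (6 * k + 4 + 1 + 1 + 1 + 1) * (6 * k + 4 + 1 + 1 + 1) *
        (6 * k + 4 + 1 + 1) * (6 * k + 4 + 1) * (6 * k + 4).factorial) * hp

end ClosedForm

/-- X^O_{2n}(1,-1) = (3n-1)!/(2ⁿ(2n-1)!) · ∏_{i=1}^{n-1} (6i-2)!/(2n+2i-1)!, where
X^O_{2n}(1,t) = ∑_{A ∈ OSASM(2n)} t^{T(A)}. -/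
theorem osasm_even_gf_at_neg_one (n : ℕ) (hn : 1 ≤ n) :
    (∑ᶠ A ∈ {A : Matrix (Fin (2*n)) (Fin (2*n)) ℤ | IsOSASMeven A},
        ((-1 : ℚ)) ^ Tstat A) =
      ((3*n-1).factorial : ℚ) / ((2:ℚ)^n * ((2*n-1).factorial : ℚ)) *
        ∏ i ∈ Finset.Icc 1 (n-1), ((6*i-2).factorial : ℚ) / ((2*n+2*i-1).factorial : ℚ) := by
  obtain ⟨k, rfl⟩ := Nat.exists_eq_add_of_le' hn
  obtain ⟨w, hw⟩ : ∃ w : ℂ, w ^ 2 + w + 1 = 0 := by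
    obtain ⟨s, hs⟩ := IsAlgClosed.exists_pow_nat_eq (-3 : ℂ) two_pos
    exact ⟨(-1 + s) / 2, by linear_combination hs / 4⟩
  have h := closedForm_mul hw k
  have hX := partitionFn_neg_one hw k
  rw [partitionFn_neg_one_eq_finsum hw] at hX
  have hprod : ∏ i ∈ Icc 1 (k + 1 - 1),
      ((6 * i - 2).factorial : ℚ) / ((2 * (k + 1) + 2 * i - 1).factorial : ℚ) =
      (∏ i ∈ range k, ((6 * i + 4).factorial : ℚ)) /
        ∏ i ∈ range k, ((2 * k + 2 * i + 3).factorial : ℚ) := by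
    rw [← prod_div_distrib, ← Ico_add_one_right_eq_Icc, prod_Ico_eq_prod_range]
    refine prod_congr rfl fun i _ => ?_
    congr 3 <;> omega
  rw [hprod]
  generalize (∑ᶠ A ∈ {A : Matrix (Fin (2 * (k + 1))) (Fin (2 * (k + 1))) ℤ | IsOSASMeven A},
    ((-1 : ℚ)) ^ Tstat A) = S at *
  rw [show 3 * (k + 1) - 1 = 3 * k + 2 by omega, show 2 * (k + 1) - 1 = 2 * k + 1 by omega]
  have hf : ((2 * k + 1).factorial : ℂ) ≠ 0 := Nat.cast_ne_zero.2 (Nat.factorial_ne_zero _)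
  have hP : (∏ i ∈ range k, ((2 * k + 2 * i + 3).factorial : ℂ)) ≠ 0 :=
    prod_ne_zero_iff.2 fun i _ => Nat.cast_ne_zero.2 (Nat.factorial_ne_zero _)
  have hD : (∏ i ∈ range (k + 1), (6 * (i : ℂ) + 1)) * ∏ i ∈ range k, (6 * (i : ℂ) + 5) ≠ 0 :=
    mul_ne_zero (prod_ne_zero_iff.2 fun i _ => by exact_mod_cast Nat.succ_ne_zero (6 * i))
      (prod_ne_zero_iff.2 fun i _ => by exact_mod_cast Nat.succ_ne_zero (6 * i + 4))
  have hpow : (-1 / 3 : ℂ) ^ k * (-1) ^ k * 3 ^ k = 1 := by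
    rw [← mul_pow, ← mul_pow]
    norm_num
  apply Rat.cast_injective (α := ℂ)
  push_cast
  rw [div_mul_div_comm, eq_div_iff (mul_ne_zero (mul_ne_zero (pow_ne_zero _ two_ne_zero) hf) hP)]
  refine mul_right_cancel₀ (mul_ne_zero (pow_ne_zero (2 * k + 1) (by norm_num : (6 : ℂ) ≠ 0)) hD) ?_
  generalize (∏ i ∈ range (k + 1), (6 * (i : ℂ) + 1)) * ∏ i ∈ range k, (6 * (i : ℂ) + 5) = D at *
  generalize (∏ i ∈ range k, ((2 * k + 2 * i + 3).factorial : ℂ)) = P at *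
  linear_combination 3 ^ k * 2 ^ (k + 1) * P * hX - h -
    S * 2 ^ (k + 1) * P * (2 * k + 1).factorial * D * 6 ^ (2 * k + 1) * hpow
end
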